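/- arXiv:0911.1652 — 2 statements merged into one kernel-verified Lean document; each statement's English description precedes it below -/
import Mathlib

section
/- Let d=1 and let φ(η,ξ) = aη² + bηξ + cξ² be a real quadratic form on ℝ² with b ≠ 0, 2a − b ≠ 0 and 2c − b ≠ 0. Let m be a bounded symbol on ℝ², and let p, q, r be exponents with p, q, r′ ∈ (1,2] and 1/r + 1 = 1/p + 1/q. Assume that the bilinear multiplier T_m extends to a bounded operator from L^{p′}(ℝ) × L^{q′}(ℝ) into L^{r′}(ℝ). Then there exists a constant C = C(p,q,r,φ,m) such that for all λ ≠ 0 and all Schwartz functions f, g on ℝ, ‖B_λ(f,g)‖_{L^r} ≤ C |λ|^{−1/2} ‖f‖_{L^p} ‖g‖_{L^q}. -/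
open MeasureTheory Filter Complex SchwartzMap
open scoped ENNReal

noncomputable section

/-- The one-dimensional Fourier transform `(2π)^{-1/2} ∫ e^{-ixξ} f(x) dx`. -/
def FT1 (f : ℝ → ℂ) (ξ : ℝ) : ℂ :=
  (((2 * Real.pi) ^ (-(1 : ℝ) / 2) : ℝ) : ℂ) *
    ∫ x : ℝ, Complex.exp (-(Complex.I * ((x * ξ : ℝ) : ℂ))) * f x

/-- The bilinear oscillatory integral `B_λ(f,g)` in dimension `1`; for `λ = 0` this is the
bilinear multiplier `T_m`. -/
def Bop1 (m : ℝ × ℝ → ℂ) (φ : ℝ × ℝ → ℝ) (lam : ℝ)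
    (f g : 𝓢(ℝ, ℂ)) (x : ℝ) : ℂ :=
  (((2 * Real.pi) ^ (-(1 : ℝ) / 2) : ℝ) : ℂ) *
    ∫ p : ℝ × ℝ,
      Complex.exp (Complex.I * ((x * (p.1 + p.2) + lam * φ p : ℝ) : ℂ)) *
        m p * FT1 (⇑f) p.1 * FT1 (⇑g) p.2

open FourierTransform in
lemma plancherel_aux (u : ℝ → ℂ) (hu : Integrable u) (hu2 : MemLp u 2 volume) :
    eLpNorm (𝓕 u) 2 volume = eLpNorm u 2 volume := by
  set U : Lp ℂ 2 (volume : Measure ℝ) := hu2.toLp u with hU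
  have hcont : Continuous (𝓕 u) :=
    VectorFourier.fourierIntegral_continuous Real.continuous_fourierChar
      (by exact continuous_inner) hu
  have hae : 𝓕 u =ᵐ[volume] ((𝓕 U : Lp ℂ 2 (volume : Measure ℝ)) : ℝ → ℂ) := by
    refine ae_eq_of_integral_contDiff_smul_eq hcont.locallyIntegrable
      ((Lp.memLp (𝓕 U)).locallyIntegrable (by norm_num)) ?_
    intro g hg hgs
    have hg1 : HasCompactSupport (fun x => (g x : ℂ)) := hgs.comp_left (g := fun x : ℝ => (x : ℂ)) (by simp)
    have hg2 : ContDiff ℝ (⊤ : ℕ∞) (fun x => (g x : ℂ)) := by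
      exact Complex.ofRealCLM.contDiff.comp hg
    set G : 𝓢(ℝ, ℂ) := hg1.toSchwartzMap hg2 with hG
    have hGx : ∀ x, G x = (g x : ℂ) := fun x => rfl
    have h1 := congrArg (fun T => T G) (Lp.fourier_toTemperedDistribution_eq U)
    simp only [Lp.toTemperedDistribution_apply, TemperedDistribution.fourier_apply] at h1
    have h2 : ∫ x, (𝓕 G : 𝓢(ℝ, ℂ)) x • (U : ℝ → ℂ) x = ∫ x, (𝓕 G : 𝓢(ℝ, ℂ)) x • u x := by
      apply integral_congr_ae
      filter_upwards [hu2.coeFn_toLp] with x hx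
      rw [hx]
    have h3 := VectorFourier.integral_fourierIntegral_smul_eq_flip (L := innerₗ ℝ) (μ := volume) (ν := volume) (f := (G : ℝ → ℂ)) (g := u) Real.continuous_fourierChar
      (by exact continuous_inner) G.integrable hu
    rw [h2] at h1
    have h4 : ∫ x, g x • (𝓕 u) x = ∫ x, G x • (𝓕 u) x := by
      simp [hGx]
    have h5 : ∫ x, g x • ((𝓕 U : Lp ℂ 2 (volume : Measure ℝ)) : ℝ → ℂ) x = ∫ x, G x • ((𝓕 U : Lp ℂ 2 (volume : Measure ℝ)) : ℝ → ℂ) x := by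
      simp [hGx]
    rw [h4, h5, ← h1]
    have h6 : (innerₗ ℝ).flip = innerₗ ℝ := by
      ext; simp 
    rw [h6] at h3
    exact h3.symm
  rw [eLpNorm_congr_ae hae]
  have h := Lp.norm_fourier_eq U
  rw [Lp.norm_def, Lp.norm_def, ENNReal.toReal_eq_toReal_iff' (Lp.eLpNorm_ne_top _) (Lp.eLpNorm_ne_top _)] at h
  rw [h]
  exact eLpNorm_congr_ae hu2.coeFn_toLp

lemma lintegral_rpow_Ioc_aux (T e : ℝ) (hT : 0 ≤ T) (he : -1 < e) :
    ∫⁻ t in Set.Ioc 0 T, ENNReal.ofReal (t ^ e) = ENNReal.ofReal (T ^ (e + 1) / (e + 1)) := by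
  have hint : IntervalIntegrable (fun t : ℝ => t ^ e) volume 0 T :=
    intervalIntegral.intervalIntegrable_rpow' he
  rw [← ofReal_integral_eq_lintegral_ofReal]
  · rw [← intervalIntegral.integral_of_le hT, integral_rpow (Or.inl he),
      Real.zero_rpow (by linarith), sub_zero]
  · exact (intervalIntegrable_iff_integrableOn_Ioc_of_le hT).1 hint
  · filter_upwards [self_mem_ae_restrict measurableSet_Ioc] with t ht
    exact Real.rpow_nonneg ht.1.le _

open FourierTransform in
lemma fourier_norm_le_aux (u : ℝ → ℂ) (x : ℝ) : ‖𝓕 u x‖ ≤ ∫ y, ‖u y‖ :=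
  VectorFourier.norm_fourierIntegral_le_integral_norm _ _ _ _ _

open FourierTransform in
lemma fourier_cont_aux (u : ℝ → ℂ) (hu : Integrable u) : Continuous (𝓕 u) :=
  VectorFourier.fourierIntegral_continuous Real.continuous_fourierChar
      (by exact continuous_inner) hu

open FourierTransform in
lemma fourier_add_aux (u v : ℝ → ℂ) (hu : Integrable u) (hv : Integrable v) (x : ℝ) :
    𝓕 (u + v) x = 𝓕 u x + 𝓕 v x := by
  have := VectorFourier.fourierIntegral_add (L := innerₗ ℝ) Real.continuous_fourierChar
      (by exact continuous_inner) hu hv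
  exact congrFun this x

open FourierTransform in
/-- The distributional estimate behind Hausdorff-Young. -/
lemma hy_level (p A t : ℝ) (hp1 : 1 < p) (hA : 0 < A) (ht : 0 < t)
    (u : ℝ → ℂ) (hm : Measurable u) (hu : Integrable u)
    (hup : Integrable (fun y => ‖u y‖ ^ p)) (hAu : ∫ y, ‖u y‖ ^ p = A) :
    volume {x | t < ‖𝓕 u x‖} ≤
      ENNReal.ofReal (4 / t ^ 2) *
        ∫⁻ y, {y | t * ‖u y‖ ^ (p - 1) ≤ 2 * A}.indicator (fun y => ENNReal.ofReal (‖u y‖ ^ 2)) y := by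
  set E : Set ℝ := {y | t * ‖u y‖ ^ (p - 1) ≤ 2 * A} with hE
  have hEm : MeasurableSet E := by
    apply measurableSet_le _ measurable_const
    exact (hm.norm.pow_const _).const_mul _
  set v := E.indicator u with hv
  set w := Eᶜ.indicator u with hw
  have hvi : Integrable v := hu.indicator hEm
  have hwi : Integrable w := hu.indicator hEm.compl
  have huvw : u = v + w := (Set.indicator_self_add_compl E u).symm
  have hwt : ∀ x, ‖𝓕 w x‖ ≤ t / 2 := by
    intro x
    refine (fourier_norm_le_aux w x).trans ?_
    calc ∫ y, ‖w y‖ ≤ ∫ y, t / (2 * A) * ‖u y‖ ^ p := by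
          apply integral_mono hwi.norm (hup.const_mul _)
          intro y
          simp only [hw]
          by_cases hy : y ∈ E
          · rw [Set.indicator_of_notMem (by simpa using hy)]
            simp only [norm_zero]; positivity
          · rw [Set.indicator_of_mem (by simpa using hy)]
            have hy' : 2 * A < t * ‖u y‖ ^ (p - 1) := by simpa [hE] using hy
            have hu0 : 0 < ‖u y‖ := by
              rcases (norm_nonneg (u y)).eq_or_lt with h | h
              · rw [← h, Real.zero_rpow (by linarith)] at hy'
                nlinarith
              · exact h
            have : ‖u y‖ ^ p = ‖u y‖ ^ (p - 1) * ‖u y‖ := by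
              rw [← Real.rpow_add_one hu0.ne']; ring_nf
            rw [this, ← mul_assoc]
            apply le_mul_of_one_le_left hu0.le
            rw [div_mul_eq_mul_div, one_le_div (by positivity)]
            exact hy'.le
      _ = t / 2 := by
          rw [integral_const_mul, hAu]; field_simp
  have hvb : ∀ y, ‖v y‖ ≤ (2 * A / t) ^ (1 / (p - 1)) := by
    intro y
    simp only [hv]
    by_cases hy : y ∈ E
    · rw [Set.indicator_of_mem hy]
      have hy' : t * ‖u y‖ ^ (p - 1) ≤ 2 * A := hy
      have h2 : ‖u y‖ ^ (p - 1) ≤ 2 * A / t := by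
        rw [le_div_iff₀ ht]; linarith
      calc ‖u y‖ = (‖u y‖ ^ (p - 1)) ^ (1 / (p - 1)) := by
            rw [← Real.rpow_mul (norm_nonneg _), mul_one_div_cancel (by linarith), Real.rpow_one]
        _ ≤ _ := Real.rpow_le_rpow (by positivity) h2 (by
            apply one_div_nonneg.2; linarith)
    · rw [Set.indicator_of_notMem hy]; simp only [norm_zero]; positivity
  have hv2 : MemLp v 2 volume := by
    rw [memLp_two_iff_integrable_sq_norm hvi.aestronglyMeasurable]
    refine (hvi.norm.const_mul ((2 * A / t) ^ (1 / (p - 1)))).mono'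
      (hvi.aestronglyMeasurable.norm.pow 2) (Eventually.of_forall fun y => ?_)
    rw [Real.norm_of_nonneg (by positivity), sq]
    gcongr
    exact hvb y
  have hsub : {x | t < ‖𝓕 u x‖} ⊆ {x | ENNReal.ofReal (t / 2) ≤ ‖𝓕 v x‖ₑ} := by
    intro x hx
    simp only [Set.mem_ofPred_eq] at hx ⊢
    rw [huvw, fourier_add_aux v w hvi hwi] at hx
    rw [← ofReal_norm]
    apply ENNReal.ofReal_le_ofReal
    have := norm_add_le (𝓕 v x) (𝓕 w x)
    have := hwt x
    linarith
  refine (measure_mono hsub).trans ?_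
  have hch := meas_ge_le_mul_pow_eLpNorm_enorm volume (p := 2) (by norm_num) (by norm_num)
    (fourier_cont_aux v hvi).aestronglyMeasurable (ε := ENNReal.ofReal (t / 2))
    (by simpa using ht) (by simp)
  refine hch.trans ?_
  rw [plancherel_aux v hvi hv2]
  have e1 : (ENNReal.ofReal (t / 2))⁻¹ ^ (2 : ℝ≥0∞).toReal = ENNReal.ofReal (4 / t ^ 2) := by
    rw [← ENNReal.ofReal_inv_of_pos (by positivity), ENNReal.ofReal_rpow_of_nonneg (by positivity) (by simp)]
    congr 1
    simp; ring
  have e2 : eLpNorm v 2 volume ^ (2 : ℝ≥0∞).toReal = ∫⁻ y, E.indicator (fun y => ENNReal.ofReal (‖u y‖ ^ 2)) y := by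
    rw [eLpNorm_eq_lintegral_rpow_enorm_toReal (by norm_num) (by norm_num), ← ENNReal.rpow_mul]
    simp only [ENNReal.toReal_ofNat, one_div]
    norm_num
    apply lintegral_congr
    intro y
    simp only [hv]
    by_cases hy : y ∈ E
    · rw [Set.indicator_of_mem hy, Set.indicator_of_mem hy, ← ofReal_norm]
    · rw [Set.indicator_of_notMem hy, Set.indicator_of_notMem hy]; simp
  rw [e1, e2]

open FourierTransform in
lemma hy_lintegral (p P A : ℝ) (hp1 : 1 < p) (hp2 : p < 2) (hP : P = p / (p - 1)) (hA : 0 < A)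
    (u : ℝ → ℂ) (hm : Measurable u) (hu : Integrable u)
    (hup : Integrable (fun y => ‖u y‖ ^ p)) (hAu : ∫ y, ‖u y‖ ^ p = A) :
    ∫⁻ x, ENNReal.ofReal (‖𝓕 u x‖ ^ P) ≤
      ENNReal.ofReal (P * 4 * (2 ^ (P - 2) / (P - 2)) * A ^ (P - 1)) := by
  have hp0 : 0 < p - 1 := by linarith
  have hP2 : 2 < P := by
    rw [hP, lt_div_iff₀ hp0]; linarith
  have hPp : (p - 1) * P = p := by rw [hP]; field_simp
  rw [lintegral_rpow_eq_lintegral_meas_lt_mul volume (Eventually.of_forall fun x => norm_nonneg _)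
    (fourier_cont_aux u hu).norm.aemeasurable (by linarith : 0 < P)]
  let F : ℝ → ℝ → ℝ≥0∞ := fun t y => (Set.Ioi (0:ℝ) ×ˢ Set.univ ∩ {z : ℝ × ℝ | z.1 * ‖u z.2‖ ^ (p - 1) ≤ 2 * A}).indicator
    (fun z => ENNReal.ofReal (4 * z.1 ^ (P - 3)) * ENNReal.ofReal (‖u z.2‖ ^ 2)) (t, y)
  have hFm : Measurable (Function.uncurry F) := by
    refine Measurable.indicator ?_ ?_
    · refine Measurable.mul (f := fun z : ℝ × ℝ => ENNReal.ofReal (4 * z.1 ^ (P - 3))) (g := fun z : ℝ × ℝ => ENNReal.ofReal (‖u z.2‖ ^ 2)) ?_ ?_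
      · exact ((measurable_fst.pow_const _).const_mul _).ennreal_ofReal
      · exact ((hm.comp measurable_snd).norm.pow_const _).ennreal_ofReal
    · refine (measurableSet_Ioi.prod MeasurableSet.univ).inter ?_
      apply measurableSet_le _ measurable_const
      exact measurable_fst.mul ((hm.comp measurable_snd).norm.pow_const _)
  have hstep : ∫⁻ t in Set.Ioi 0, volume {x | t < ‖𝓕 u x‖} * ENNReal.ofReal (t ^ (P - 1)) ≤
      ∫⁻ t, ∫⁻ y, F t y := by
    rw [← lintegral_indicator measurableSet_Ioi]
    apply lintegral_mono
    intro t
    by_cases ht : t ∈ Set.Ioi (0:ℝ)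
    swap
    · simp [Set.indicator_of_notMem ht]
    rw [Set.indicator_of_mem ht]
    have ht' : 0 < t := ht
    calc _ ≤ (ENNReal.ofReal (4 / t ^ 2) *
        ∫⁻ y, {y | t * ‖u y‖ ^ (p - 1) ≤ 2 * A}.indicator (fun y => ENNReal.ofReal (‖u y‖ ^ 2)) y) * ENNReal.ofReal (t ^ (P - 1)) := by
          gcongr
          exact hy_level p A t hp1 hA ht u hm hu hup hAu
      _ = ENNReal.ofReal (4 * t ^ (P - 3)) * ∫⁻ y, {y | t * ‖u y‖ ^ (p - 1) ≤ 2 * A}.indicator (fun y => ENNReal.ofReal (‖u y‖ ^ 2)) y := by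
          rw [mul_right_comm, ← ENNReal.ofReal_mul (by positivity)]
          congr 2
          have : P - 1 = (P - 3) + (2:ℕ) := by push_cast; ring
          rw [this, Real.rpow_add_natCast ht'.ne']
          field_simp
      _ ≤ ∫⁻ y, F t y := by
          rw [← lintegral_const_mul' _ _ ENNReal.ofReal_ne_top]
          apply lintegral_mono
          intro y
          simp only [F, Set.indicator_apply, Set.mem_ofPred_eq, Set.mem_inter_iff, Set.mem_prod, ht, Set.mem_univ, true_and]
          split_ifs <;> simp
  have hinner : ∀ y, ∫⁻ t, F t y ≤ ENNReal.ofReal (4 * (2 ^ (P - 2) / (P - 2)) * A ^ (P - 2) * ‖u y‖ ^ p) := by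
    intro y
    rcases (norm_nonneg (u y)).eq_or_lt with h | h
    · have h0 : ∀ t, F t y = 0 := by
        intro t
        simp only [F, Set.indicator_apply]
        split_ifs
        · simp only [← h]; simp
        · rfl
      simp [h0]
    · set W := ‖u y‖ with hW
      have : ∀ t, F t y = (Set.Ioc 0 (2 * A / W ^ (p - 1))).indicator (fun t => ENNReal.ofReal (4 * W ^ 2) * ENNReal.ofReal (t ^ (P - 3))) t := by
        intro t
        simp only [F, Set.indicator_apply, Set.mem_ofPred_eq, Set.mem_inter_iff, Set.mem_prod, Set.mem_Ioi, Set.mem_univ, and_true, Set.mem_Ioc, ← hW]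
        simp only [le_div_iff₀ (show 0 < W ^ (p - 1) by positivity)]
        split_ifs with h1
        · have h10 := h1.1
          rw [← ENNReal.ofReal_mul (by positivity), ← ENNReal.ofReal_mul (by positivity)]
          congr 1; ring
        · rfl
      simp_rw [this]
      rw [lintegral_indicator measurableSet_Ioc, lintegral_const_mul' _ _ ENNReal.ofReal_ne_top,
        lintegral_rpow_Ioc_aux _ _ (by positivity) (by linarith), ← ENNReal.ofReal_mul (by positivity)]
      apply le_of_eq
      congr 1
      have e1 : P - 3 + 1 = P - 2 := by ring
      rw [e1, Real.div_rpow (by positivity) (by positivity), Real.mul_rpow (by positivity) (by positivity),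
        ← Real.rpow_mul h.le]
      have e2 : (p - 1) * (P - 2) = 2 - p := by linear_combination hPp
      have e3 : W ^ 2 = W ^ p * W ^ (2 - p) := by
        rw [← Real.rpow_add h, ← Real.rpow_natCast]; congr 1; push_cast; ring
      rw [e2, e3]
      have : 0 < W ^ (2 - p) := by positivity
      field_simp
  calc _ ≤ ENNReal.ofReal P * ∫⁻ t, ∫⁻ y, F t y := by gcongr
    _ = ENNReal.ofReal P * ∫⁻ y, ∫⁻ t, F t y := by
        rw [lintegral_lintegral_swap hFm.aemeasurable]
    _ ≤ ENNReal.ofReal P * ∫⁻ y, ENNReal.ofReal (4 * (2 ^ (P - 2) / (P - 2)) * A ^ (P - 2) * ‖u y‖ ^ p) := by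
        gcongr with y
        exact hinner y
    _ = _ := by
        have hP2' : 0 < P - 2 := by linarith
        rw [← ofReal_integral_eq_lintegral_ofReal (hup.const_mul _) (Eventually.of_forall fun y => by positivity),
          integral_const_mul, hAu, ← ENNReal.ofReal_mul (by linarith)]
        congr 1
        have : P - 1 = P - 2 + 1 := by ring
        rw [this, Real.rpow_add_one hA.ne']
        ring


open FourierTransform in
/-- Hausdorff-Young, with an unspecified constant. -/
lemma hausdorff_young_aux (p : ℝ) (hp1 : 1 < p) (hp2 : p ≤ 2) :
    ∃ C : ℝ, 0 < C ∧ ∀ u : ℝ → ℂ, Measurable u → Integrable u →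
      eLpNorm (𝓕 u) (ENNReal.ofReal (p / (p - 1))) volume ≤
        ENNReal.ofReal C * eLpNorm u (ENNReal.ofReal p) volume := by
  rcases hp2.eq_or_lt with rfl | hp2
  · refine ⟨1, one_pos, fun u hm hu => ?_⟩
    have e1 : ENNReal.ofReal (2 / (2 - 1)) = 2 := by norm_num
    have e2 : ENNReal.ofReal 2 = 2 := by norm_num
    rw [e1, e2, ENNReal.ofReal_one, one_mul]
    by_cases h : eLpNorm u 2 volume = ⊤
    · rw [h]; exact le_top
    · exact (plancherel_aux u hu ⟨hu.1, lt_top_iff_ne_top.2 h⟩).le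
  · set P := p / (p - 1) with hP
    have hp0 : 0 < p - 1 := by linarith
    have hP2 : 2 < P := by
      rw [hP, lt_div_iff₀ hp0]; linarith
    have hP2' : 0 < P - 2 := by linarith
    have hP0 : 0 < P := by linarith
    set B := P * 4 * (2 ^ (P - 2) / (P - 2)) with hB
    have hB0 : 0 < B := by positivity
    refine ⟨B ^ (1 / P), by positivity, fun u hm hu => ?_⟩
    have hpt : (ENNReal.ofReal p).toReal = p := ENNReal.toReal_ofReal (by linarith)
    have hPt : (ENNReal.ofReal P).toReal = P := ENNReal.toReal_ofReal (by linarith)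
    have hpn : ENNReal.ofReal p ≠ 0 := by
      simp; linarith
    have hPn : ENNReal.ofReal P ≠ 0 := by
      simp; linarith
    by_cases h : eLpNorm u (ENNReal.ofReal p) volume = ⊤
    · rw [h, ENNReal.mul_top]
      · exact le_top
      · simp; positivity
    have hup' : MemLp u (ENNReal.ofReal p) volume := ⟨hu.1, lt_top_iff_ne_top.2 h⟩
    have hup : Integrable (fun y => ‖u y‖ ^ p) := by
      have := hup'.integrable_norm_rpow hpn ENNReal.ofReal_ne_top
      rwa [hpt] at this
    set A := ∫ y, ‖u y‖ ^ p with hA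
    have hA0 : 0 ≤ A := integral_nonneg fun y => by positivity
    have hnorm : eLpNorm u (ENNReal.ofReal p) volume = ENNReal.ofReal (A ^ (1 / p)) := by
      rw [hup'.eLpNorm_eq_integral_rpow_norm hpn ENNReal.ofReal_ne_top, hpt, one_div]
    rcases hA0.eq_or_lt with h0 | hA0
    · have h1 : u =ᵐ[volume] 0 := by
        have := (integral_eq_zero_iff_of_nonneg (fun y => by positivity) hup).1 (hA.symm.trans h0.symm)
        filter_upwards [this] with y hy
        simp only [Pi.zero_apply] at hy ⊢
        rw [Real.rpow_eq_zero (norm_nonneg _) (by linarith)] at hy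
        simpa using hy
      have h2 : 𝓕 u = 0 := by
        ext x
        have := fourier_norm_le_aux u x
        rw [integral_congr_ae (g := fun _ => (0:ℝ)) (by filter_upwards [h1] with y hy; simp [hy])] at this
        simpa using this
      rw [h2]; simp
    · have key := hy_lintegral p P A hp1 hp2 hP hA0 u hm hu hup hA.symm
      rw [hnorm, eLpNorm_eq_lintegral_rpow_enorm_toReal hPn ENNReal.ofReal_ne_top, hPt]
      have e : ∫⁻ x, ‖𝓕 u x‖ₑ ^ P = ∫⁻ x, ENNReal.ofReal (‖𝓕 u x‖ ^ P) := by
        apply lintegral_congr; intro x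
        rw [← ofReal_norm, ENNReal.ofReal_rpow_of_nonneg (norm_nonneg _) hP0.le]
      rw [e]
      calc _ ≤ (ENNReal.ofReal (B * A ^ (P - 1))) ^ (1 / P) := by gcongr
        _ = _ := by
          rw [ENNReal.ofReal_rpow_of_nonneg (by positivity) (by positivity),
            ← ENNReal.ofReal_mul (by positivity), Real.mul_rpow (by positivity) (by positivity),
            ← Real.rpow_mul hA0.le]
          have : (P - 1) * (1 / P) = 1 / p := by
            rw [hP]; field_simp; ring
          rw [this]

lemma eLpNorm_comp_mul_aux (v : ℝ → ℂ) (s P : ℝ) (hs : s ≠ 0) (hP : 0 < P) (hv : Continuous v) :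
    eLpNorm (fun x => v (s * x)) (ENNReal.ofReal P) volume =
      ENNReal.ofReal (|s⁻¹| ^ (1 / P)) * eLpNorm v (ENNReal.ofReal P) volume := by
  have hmap := Real.map_volume_mul_left hs
  have h1 : eLpNorm v (ENNReal.ofReal P) (Measure.map (s * ·) volume) =
      eLpNorm (fun x => v (s * x)) (ENNReal.ofReal P) volume := by
    rw [eLpNorm_map_measure hv.aestronglyMeasurable (measurable_const_mul s).aemeasurable]
    rfl
  have e : (1 / ENNReal.ofReal P).toReal = 1 / P := by
    rw [ENNReal.toReal_div, ENNReal.toReal_ofReal hP.le]; simp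
  rw [← h1, hmap, eLpNorm_smul_measure_of_ne_top ENNReal.ofReal_ne_top, e]
  rw [ENNReal.ofReal_rpow_of_nonneg (by positivity) (by positivity), smul_eq_mul]

open FourierTransform in
/-- Fourier transform of a Gaussian-regularised superposition of plane waves. -/
lemma fourier_gauss_aux {Ω : Type} [MeasurableSpace Ω] (μ : Measure Ω) [SFinite μ]
    (θ : Ω → ℝ) (hθ : Measurable θ) (K : Ω → ℂ) (hK : Integrable K μ) (z : ℂ) (hz : 0 < z.re) (w : ℝ) :
    𝓕 (fun y : ℝ => cexp (-z * (y:ℂ) ^ 2) * ∫ ω, cexp (I * ((y * θ ω : ℝ) : ℂ)) * K ω ∂μ) w =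
      ∫ ω, (Real.pi / z) ^ (1 / 2 : ℂ) * cexp (-((θ ω - 2 * Real.pi * w : ℝ) : ℂ) ^ 2 / (4 * z)) * K ω ∂μ := by
  rw [Real.fourier_eq']
  have hint : Integrable (fun q : ℝ × Ω => cexp (-z * (q.1:ℂ) ^ 2 + (I * ((θ q.2 - 2 * Real.pi * w : ℝ) : ℂ)) * q.1) * K q.2) (volume.prod μ) := by
    have h0 : Integrable (fun q : ℝ × Ω => cexp (-z * (q.1:ℂ) ^ 2) * K q.2) (volume.prod μ) :=
      (integrable_cexp_neg_mul_sq hz).mul_prod hK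
    have h1 : Measurable (fun q : ℝ × Ω => cexp ((I * ((θ q.2 - 2 * Real.pi * w : ℝ) : ℂ)) * q.1)) := by
      fun_prop
    refine (h0.bdd_mul (c := 1) h1.aestronglyMeasurable (Eventually.of_forall fun q => ?_)).congr (Eventually.of_forall fun q => ?_)
    · rw [Complex.norm_exp]; simp
    · simp only [Complex.exp_add]; ring
  calc _ = ∫ y : ℝ, ∫ ω, cexp (-z * (y:ℂ) ^ 2 + (I * ((θ ω - 2 * Real.pi * w : ℝ) : ℂ)) * y) * K ω ∂μ := by
        congr 1; ext y
        rw [smul_eq_mul, ← mul_assoc, ← integral_const_mul]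
        congr 1; ext ω
        rw [← mul_assoc, ← Complex.exp_add, ← Complex.exp_add]
        congr 2
        simp
        ring
    _ = ∫ ω, (∫ y : ℝ, cexp (-z * (y:ℂ) ^ 2 + (I * ((θ ω - 2 * Real.pi * w : ℝ) : ℂ)) * y) * K ω) ∂μ :=
        integral_integral_swap hint
    _ = _ := by
        congr 1; ext ω
        rw [integral_mul_const]
        congr 1
        have := fourierIntegral_gaussian hz ((θ ω - 2 * Real.pi * w : ℝ) : ℂ)
        rw [← this]
        congr 1; ext y
        rw [← Complex.exp_add]; congr 1; ring

lemma re_inv_nonneg_aux (z : ℂ) (hz : 0 < z.re) (a : ℝ) : ‖cexp (-(a : ℂ) ^ 2 / (4 * z))‖ ≤ 1 := by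
  rw [Complex.norm_exp, Real.exp_le_one_iff]
  have : (-(a : ℂ) ^ 2 / (4 * z)) = (((-(a ^ 2) / 4 : ℝ)) : ℂ) * z⁻¹ := by
    push_cast
    have : z ≠ 0 := by rintro rfl; simp at hz
    field_simp
  rw [this, Complex.re_ofReal_mul, Complex.inv_re]
  have : 0 ≤ z.re / normSq z := by have := Complex.normSq_nonneg z; positivity
  nlinarith [sq_nonneg a]

open FourierTransform Topology in
lemma dispersive_aux (p : ℝ) (hp1 : 1 < p) (hp2 : p ≤ 2) :
    ∃ C : ℝ, 0 < C ∧ ∀ (Ω : Type) (_ : MeasurableSpace Ω) (μ : Measure Ω) (_ : SFinite μ)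
      (θ : Ω → ℝ) (_ : Measurable θ) (K : Ω → ℂ) (t : ℝ), t ≠ 0 →
      eLpNorm (fun x : ℝ => ∫ ω, cexp (I * ((x * θ ω + t * θ ω ^ 2 : ℝ) : ℂ)) * K ω ∂μ)
          (ENNReal.ofReal (p / (p - 1))) volume ≤
        ENNReal.ofReal (C * |t| ^ (1 / 2 - 1 / p)) *
          eLpNorm (fun x : ℝ => ∫ ω, cexp (I * ((x * θ ω : ℝ) : ℂ)) * K ω ∂μ)
            (ENNReal.ofReal p) volume := by
  obtain ⟨C, hC, hHY⟩ := hausdorff_young_aux p hp1 hp2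
  have hp0 : 0 < p - 1 := by linarith
  have hP0 : 0 < p / (p - 1) := by positivity
  refine ⟨C * (4 * Real.pi) ^ (1 / 2 - 1 / p), by positivity, ?_⟩
  intro Ω _ μ _ θ hθ K t ht
  by_cases hK : Integrable K μ
  swap
  · have : (fun x : ℝ => ∫ ω, cexp (I * ((x * θ ω + t * θ ω ^ 2 : ℝ) : ℂ)) * K ω ∂μ) = 0 := by
      ext x
      apply integral_undef
      intro h
      apply hK
      have hmeas : Measurable (fun ω => cexp (-(I * ((x * θ ω + t * θ ω ^ 2 : ℝ) : ℂ)))) := by fun_prop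
      refine (h.bdd_mul (c := 1) hmeas.aestronglyMeasurable (Eventually.of_forall fun ω => ?_)).congr (Eventually.of_forall fun ω => ?_)
      · rw [Complex.norm_exp]; simp [-ofReal_add, -ofReal_mul, -ofReal_pow]
      · simp only []
        rw [← mul_assoc, ← Complex.exp_add]; simp
    rw [this]; simp
  set H : ℝ → ℂ := fun x : ℝ => ∫ ω, cexp (I * ((x * θ ω : ℝ) : ℂ)) * K ω ∂μ with hH
  set G : ℝ → ℂ := fun x : ℝ => ∫ ω, cexp (I * ((x * θ ω + t * θ ω ^ 2 : ℝ) : ℂ)) * K ω ∂μ with hG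
  have hHc : Continuous H := by
    refine continuous_of_dominated (F := fun x ω => cexp (I * ((x * θ ω : ℝ) : ℂ)) * K ω) (bound := fun ω => ‖K ω‖) ?_ ?_ hK.norm ?_
    · intro x
      have hmeas : Measurable (fun ω => cexp ((I * ((x * θ ω : ℝ) : ℂ)))) := by fun_prop
      exact hmeas.aestronglyMeasurable.mul hK.1
    · intro x
      refine Eventually.of_forall fun ω => ?_
      rw [norm_mul, Complex.norm_exp]; simp
    · refine Eventually.of_forall fun ω => ?_
      fun_prop
  have hHb : ∀ x, ‖H x‖ ≤ ∫ ω, ‖K ω‖ ∂μ := by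
    intro x
    refine (norm_integral_le_integral_norm _).trans (le_of_eq ?_)
    congr 1; ext ω
    rw [norm_mul, Complex.norm_exp]; simp
  set z : ℕ → ℂ := fun n => ((1 / ((n:ℝ) + 1) : ℝ) : ℂ) + ((1 / (4 * t) : ℝ) : ℂ) * I with hz
  have hzre : ∀ n, 0 < (z n).re := by
    intro n
    have : (z n).re = 1 / ((n:ℝ) + 1) := by simp [hz, -one_div, -ofReal_div]
    rw [this]; positivity
  set z0 : ℂ := ((1 / (4 * t) : ℝ) : ℂ) * I with hz0
  have hz0ne : z0 ≠ 0 := by simp [hz0, ht, I_ne_zero]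
  have hzlim : Tendsto z atTop (𝓝 z0) := by
    have h1 : Tendsto (fun n : ℕ => ((1 / ((n:ℝ) + 1) : ℝ) : ℂ)) atTop (𝓝 ((0:ℝ):ℂ)) :=
      (Complex.continuous_ofReal.tendsto 0).comp tendsto_one_div_add_atTop_nhds_zero_nat
    have := h1.add_const z0
    simpa [hz, hz0] using this
  have hpiz0 : (Real.pi : ℂ) / z0 = ((-4 * Real.pi * t : ℝ) : ℂ) * I := by
    rw [div_eq_iff hz0ne, hz0]
    push_cast
    have : (t : ℂ) ≠ 0 := by exact_mod_cast ht
    field_simp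
    rw [I_sq]; ring
  have hslit : (Real.pi : ℂ) / z0 ∈ slitPlane := by
    rw [hpiz0]; right; simp [ht, Real.pi_ne_zero]
  set c : ℂ := (Real.pi / z0) ^ (1 / 2 : ℂ) with hc
  have hclim : Tendsto (fun n => ((Real.pi : ℂ) / z n) ^ (1 / 2 : ℂ)) atTop (𝓝 c) := by
    have h1 : Tendsto (fun n => (Real.pi : ℂ) / z n) atTop (𝓝 (Real.pi / z0)) :=
      tendsto_const_nhds.div hzlim hz0ne
    exact h1.cpow tendsto_const_nhds hslit
  have hcn : ‖c‖ = (4 * Real.pi * |t|) ^ (1 / 2 : ℝ) := by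
    have : (1 / 2 : ℂ) = ((1 / 2 : ℝ) : ℂ) := by push_cast; rfl
    rw [hc, this, Complex.norm_cpow_real, hpiz0]
    congr 1
    simp [abs_of_pos Real.pi_pos]
  have hcpos : 0 < ‖c‖ := by rw [hcn]; positivity
  set u : ℕ → ℝ → ℂ := fun n y => cexp (-z n * (y:ℂ) ^ 2) * H y with hu
  have huc : ∀ n, Continuous (u n) := by intro n; simp only [hu]; fun_prop
  have hui : ∀ n, Integrable (u n) := by
    intro n
    exact (integrable_cexp_neg_mul_sq (hzre n)).mul_bdd (c := ∫ ω, ‖K ω‖ ∂μ) hHc.aestronglyMeasurable (Eventually.of_forall hHb)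
  set s : ℝ := -(1 / (4 * Real.pi * t)) with hs
  have hsne : s ≠ 0 := by simp [hs, ht, Real.pi_ne_zero]
  let d : ℝ → ℂ := fun x => c * cexp (I * ((x ^ 2 / (4 * t) : ℝ) : ℂ))
  have hdn : ∀ x, ‖d x‖ = ‖c‖ := by
    intro x; simp only [d]; rw [norm_mul, Complex.norm_exp]; simp [-ofReal_div]
  have hdne : ∀ x, d x ≠ 0 := by intro x h; have := hdn x; rw [h] at this; simp at this; simp [← this] at hcpos
  have hlim : ∀ x, Tendsto (fun n => (d x)⁻¹ * 𝓕 (u n) (s * x)) atTop (𝓝 (G x)) := by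
    intro x
    have h1 : Tendsto (fun n => 𝓕 (u n) (s * x)) atTop (𝓝 (d x * G x)) := by
      have heq : ∀ n, 𝓕 (u n) (s * x) = ((Real.pi : ℂ) / z n) ^ (1 / 2 : ℂ) * ∫ ω, cexp (-((θ ω - 2 * Real.pi * (s * x) : ℝ) : ℂ) ^ 2 / (4 * z n)) * K ω ∂μ := by
        intro n
        rw [← integral_const_mul]
        simp only [hu, hH]
        rw [fourier_gauss_aux μ θ hθ K hK (z n) (hzre n)]
        simp only [mul_assoc]
      simp only [heq]
      have hd : d x * G x = c * (cexp (I * ((x ^ 2 / (4 * t) : ℝ) : ℂ)) * G x) := by simp only [d]; ring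
      rw [hd]
      apply hclim.mul
      have hG' : cexp (I * ((x ^ 2 / (4 * t) : ℝ) : ℂ)) * G x = ∫ ω, cexp (-((θ ω - 2 * Real.pi * (s * x) : ℝ) : ℂ) ^ 2 / (4 * z0)) * K ω ∂μ := by
        simp only [hG]
        rw [← integral_const_mul]
        congr 1; ext ω
        rw [← mul_assoc, ← Complex.exp_add]
        congr 2
        rw [eq_div_iff (by simpa using hz0ne), hz0, hs]
        push_cast
        have : (t : ℂ) ≠ 0 := by exact_mod_cast ht
        have : (Real.pi : ℂ) ≠ 0 := by exact_mod_cast Real.pi_ne_zero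
        field_simp
        ring_nf
        simp only [I_sq]
        ring
      rw [hG']
      refine tendsto_integral_of_dominated_convergence (fun ω => ‖K ω‖) ?_ hK.norm ?_ ?_
      · intro n
        have hmeas : Measurable (fun ω => cexp (-((θ ω - 2 * Real.pi * (s * x) : ℝ) : ℂ) ^ 2 / (4 * z n))) := by fun_prop
        exact hmeas.aestronglyMeasurable.mul hK.1
      · intro n
        refine Eventually.of_forall fun ω => ?_
        rw [norm_mul]
        exact mul_le_of_le_one_left (norm_nonneg _) (re_inv_nonneg_aux _ (hzre n) _)
      · refine Eventually.of_forall fun ω => ?_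
        refine Tendsto.mul_const _ ?_
        refine (Complex.continuous_exp.tendsto _).comp ?_
        exact tendsto_const_nhds.div (hzlim.const_mul 4) (by simpa using hz0ne)
    have := h1.const_mul (d x)⁻¹
    rwa [← mul_assoc, inv_mul_cancel₀ (hdne x), one_mul] at this
  have hdc : Continuous d := by simp only [d]; fun_prop
  have hfat := Lp.eLpNorm_lim_le_liminf_eLpNorm (p := ENNReal.ofReal (p / (p - 1))) (μ := volume)
    (f := fun n x => (d x)⁻¹ * 𝓕 (u n) (s * x))
    (fun n => ((hdc.inv₀ hdne).mul ((fourier_cont_aux _ (hui n)).comp (continuous_const.mul continuous_id))).aestronglyMeasurable) G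
    (Eventually.of_forall hlim)
  refine hfat.trans ?_
  refine liminf_le_of_frequently_le' (Frequently.of_forall fun n => ?_)
  have b1 : eLpNorm (fun x => (d x)⁻¹ * 𝓕 (u n) (s * x)) (ENNReal.ofReal (p / (p - 1))) volume ≤
      ENNReal.ofReal (‖c‖⁻¹) * eLpNorm (fun x => 𝓕 (u n) (s * x)) (ENNReal.ofReal (p / (p - 1))) volume := by
    apply eLpNorm_le_mul_eLpNorm_of_ae_le_mul
    refine Eventually.of_forall fun x => ?_
    rw [norm_mul, norm_inv, hdn]
  have b2 : eLpNorm (u n) (ENNReal.ofReal p) volume ≤ eLpNorm H (ENNReal.ofReal p) volume := by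
    apply eLpNorm_mono
    intro y
    simp only [hu]
    rw [norm_mul]
    apply mul_le_of_le_one_left (norm_nonneg _)
    rw [Complex.norm_exp, Real.exp_le_one_iff]
    have : (-z n * (y:ℂ) ^ 2).re = -((z n).re * y ^ 2) := by
      rw [← Complex.ofReal_pow, Complex.re_mul_ofReal]; simp
    rw [this]
    have := hzre n
    simp only [Left.neg_nonpos_iff]
    positivity
  rw [eLpNorm_comp_mul_aux _ s _ hsne hP0 (fourier_cont_aux _ (hui n))] at b1
  have b3 := hHY (u n) (huc n).measurable (hui n)
  calc _ ≤ _ := b1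
    _ ≤ ENNReal.ofReal (‖c‖⁻¹) * (ENNReal.ofReal (|s⁻¹| ^ (1 / (p / (p - 1)))) * (ENNReal.ofReal C * eLpNorm H (ENNReal.ofReal p) volume)) := by
        gcongr
        exact b3.trans (by gcongr)
    _ = _ := by
        rw [← mul_assoc, ← mul_assoc, ← ENNReal.ofReal_mul (by positivity), ← ENNReal.ofReal_mul (by positivity)]
        congr 2
        have hsi : |s⁻¹| = 4 * Real.pi * |t| := by
          rw [hs]; simp [abs_mul, abs_of_pos Real.pi_pos]
        have e : (1 / 2 - 1 / p : ℝ) = 1 / (p / (p - 1)) + -(1 / 2) := by field_simp; ring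
        rw [hcn, hsi, ← Real.rpow_neg (by positivity), mul_assoc C, ← Real.mul_rpow (by positivity) (by positivity), e,
          Real.rpow_add (by positivity)]
        ring

lemma hasTemperateGrowth_cexp_aux : Function.HasTemperateGrowth (fun x : ℝ => cexp (I * (x : ℂ))) := by
  refine ⟨?_, fun n => ⟨0, 1, fun x => ?_⟩⟩
  · exact (contDiff_const.mul Complex.ofRealCLM.contDiff).cexp
  · have h : ∀ n : ℕ, iteratedDeriv n (fun x : ℝ => cexp (I * (x : ℂ))) = fun x : ℝ => I ^ n * cexp (I * (x : ℂ)) := by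
      intro n
      induction n with
      | zero => simp
      | succ n ih =>
        rw [iteratedDeriv_succ, ih]
        ext x
        have h1 : HasDerivAt (fun x : ℝ => I * (x : ℂ)) (I * 1) x :=
          (Complex.ofRealCLM.hasDerivAt (x := x)).const_mul I
        rw [(h1.cexp.const_mul (I ^ n)).deriv]
        ring
    rw [norm_iteratedFDeriv_eq_norm_iteratedDeriv, h, norm_mul, norm_pow, Complex.norm_exp]
    simp

lemma hasTemperateGrowth_chirp_aux (α : ℝ) : Function.HasTemperateGrowth
    (fun w : ℝ => cexp (I * ((α * (2 * Real.pi * w) ^ 2 : ℝ) : ℂ))) := by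
  have h : Function.HasTemperateGrowth (fun w : ℝ => α * (2 * Real.pi * w) ^ 2) := by
    fun_prop
  exact hasTemperateGrowth_cexp_aux.comp h

open FourierTransform in
lemma FT1_eq_aux (f : 𝓢(ℝ, ℂ)) (ξ : ℝ) : FT1 (⇑f) ξ =
    (((2 * Real.pi) ^ (-(1 : ℝ) / 2) : ℝ) : ℂ) * (𝓕 f : 𝓢(ℝ, ℂ)) (ξ / (2 * Real.pi)) := by
  rw [FT1, SchwartzMap.fourier_coe, Real.fourier_real_eq_integral_exp_smul]
  congr 2
  ext x
  rw [smul_eq_mul]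
  congr 2
  have : (Real.pi : ℂ) ≠ 0 := by exact_mod_cast Real.pi_ne_zero
  push_cast
  field_simp

open FourierTransform in
lemma schrodinger_aux (α : ℝ) (f : 𝓢(ℝ, ℂ)) : ∃ F : 𝓢(ℝ, ℂ),
    (∀ ξ, FT1 (⇑F) ξ = cexp (I * ((α * ξ ^ 2 : ℝ) : ℂ)) * FT1 (⇑f) ξ) ∧
    (∀ x, F x = ∫ w : ℝ, cexp (I * ((x * (2 * Real.pi * w) + α * (2 * Real.pi * w) ^ 2 : ℝ) : ℂ)) *
      (𝓕 f : 𝓢(ℝ, ℂ)) w) := by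
  set g : 𝓢(ℝ, ℂ) := smulLeftCLM ℂ (fun w : ℝ => cexp (I * ((α * (2 * Real.pi * w) ^ 2 : ℝ) : ℂ))) (𝓕 f : 𝓢(ℝ, ℂ)) with hg
  have hgx : ∀ w, g w = cexp (I * ((α * (2 * Real.pi * w) ^ 2 : ℝ) : ℂ)) * (𝓕 f : 𝓢(ℝ, ℂ)) w := by
    intro w
    rw [hg, smulLeftCLM_apply_apply (hasTemperateGrowth_chirp_aux α), smul_eq_mul]
  refine ⟨𝓕⁻ g, fun ξ => ?_, fun x => ?_⟩
  · rw [FT1_eq_aux, FT1_eq_aux, fourier_fourierInv_eq, hgx]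
    have : 2 * Real.pi * (ξ / (2 * Real.pi)) = ξ := by have := Real.pi_ne_zero; field_simp
    rw [this]; ring
  · rw [SchwartzMap.fourierInv_coe, Real.fourierInv_eq']
    congr 1; ext w
    rw [hgx, smul_eq_mul, ← mul_assoc, ← Complex.exp_add]
    congr 2
    simp
    ring

open FourierTransform in
lemma inversion_aux (f : 𝓢(ℝ, ℂ)) : (⇑f : ℝ → ℂ) = fun x : ℝ => ∫ w : ℝ, cexp (I * ((x * (2 * Real.pi * w) : ℝ) : ℂ)) *
      (𝓕 f : 𝓢(ℝ, ℂ)) w := by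
  ext x
  have h : (𝓕⁻ (𝓕 f : 𝓢(ℝ, ℂ)) : 𝓢(ℝ, ℂ)) x = f x := by rw [fourierInv_fourier_eq]
  rw [← h, SchwartzMap.fourierInv_coe, Real.fourierInv_eq']
  congr 1; ext w
  rw [smul_eq_mul]
  congr 2
  simp
  ring

/-- Let `φ(η,ξ) = aη² + bηξ + cξ²` with `b ≠ 0`, `2a - b ≠ 0`, `2c - b ≠ 0`,
and let `m` be a bounded symbol on `ℝ²`. If `p, q, r' ∈ (1,2]` satisfy `1/r + 1 = 1/p + 1/q`
and the bilinear multiplier `T_m` is bounded from `L^{p'} × L^{q'}` into `L^{r'}`, then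
`‖B_λ(f,g)‖_{L^r} ≤ C |λ|^{-1/2} ‖f‖_{L^p} ‖g‖_{L^q}` for all `λ ≠ 0`. -/
theorem statement0 (a b c : ℝ) (hb : b ≠ 0) (hab : 2 * a - b ≠ 0) (hcb : 2 * c - b ≠ 0)
    (φ : ℝ × ℝ → ℝ)
    (hφ : ∀ p : ℝ × ℝ, φ p = a * p.1 ^ 2 + b * p.1 * p.2 + c * p.2 ^ 2)
    (m : ℝ × ℝ → ℂ) (hm : ∃ M : ℝ, ∀ p : ℝ × ℝ, ‖m p‖ ≤ M)
    (p q r : ℝ) (hp1 : 1 < p) (hp2 : p ≤ 2) (hq1 : 1 < q) (hq2 : q ≤ 2)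
    (hr1 : 1 < r / (r - 1)) (hr2 : r / (r - 1) ≤ 2)
    (hpqr : 1 / r + 1 = 1 / p + 1 / q)
    (hTm : ∃ C₀ : ℝ, ∀ f g : 𝓢(ℝ, ℂ),
      eLpNorm (Bop1 m φ 0 f g) (ENNReal.ofReal (r / (r - 1))) volume ≤
        ENNReal.ofReal C₀ *
          (eLpNorm (⇑f) (ENNReal.ofReal (p / (p - 1))) volume *
            eLpNorm (⇑g) (ENNReal.ofReal (q / (q - 1))) volume)) :
    ∃ C : ℝ, ∀ lam : ℝ, lam ≠ 0 → ∀ f g : 𝓢(ℝ, ℂ),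
      eLpNorm (Bop1 m φ lam f g) (ENNReal.ofReal r) volume ≤
        ENNReal.ofReal (C * |lam| ^ (-(1 : ℝ) / 2)) *
          (eLpNorm (⇑f) (ENNReal.ofReal p) volume *
            eLpNorm (⇑g) (ENNReal.ofReal q) volume) := by
  obtain ⟨C₀, hC₀⟩ := hTm
  have hr : 1 < r := by
    by_contra hcon
    push Not at hcon
    rcases hcon.eq_or_lt with h | h
    · rw [h] at hr1; norm_num at hr1
    · rw [lt_div_iff_of_neg (by linarith)] at hr1
      linarith
  have hr0 : r - 1 ≠ 0 := by linarith
  set R := r / (r - 1) with hR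
  have hRr : R / (R - 1) = r := by
    rw [hR]; field_simp; ring_nf
  obtain ⟨Cp, hCp, hdp⟩ := dispersive_aux p hp1 hp2
  obtain ⟨Cq, hCq, hdq⟩ := dispersive_aux q hq1 hq2
  obtain ⟨CR, hCR, hdR⟩ := dispersive_aux R hr1 hr2
  rw [hRr] at hdR
  have ha0 : a - b / 2 ≠ 0 := fun h => hab (by linarith)
  have hc0 : c - b / 2 ≠ 0 := fun h => hcb (by linarith)
  have hb0 : b / 2 ≠ 0 := div_ne_zero hb two_ne_zero
  refine ⟨(CR * |b / 2| ^ (1 / 2 - 1 / R)) * (max C₀ 0) *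
    ((Cp * |a - b / 2| ^ (1 / 2 - 1 / p)) * (Cq * |c - b / 2| ^ (1 / 2 - 1 / q))), ?_⟩
  intro lam hlam f g
  obtain ⟨F, hF1, hF2⟩ := schrodinger_aux (lam * (a - b / 2)) f
  obtain ⟨G, hG1, hG2⟩ := schrodinger_aux (lam * (c - b / 2)) g
  have hm2 : Measurable (fun w : ℝ => 2 * Real.pi * w) := by fun_prop
  have bF : eLpNorm (⇑F) (ENNReal.ofReal (p / (p - 1))) volume ≤
      ENNReal.ofReal (Cp * |lam * (a - b / 2)| ^ (1 / 2 - 1 / p)) * eLpNorm (⇑f) (ENNReal.ofReal p) volume := by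
    have h := hdp ℝ _ volume inferInstance _ hm2 (⇑(FourierTransform.fourier f : 𝓢(ℝ, ℂ))) _ (mul_ne_zero hlam ha0)
    rw [← inversion_aux f] at h
    rwa [show (⇑F : ℝ → ℂ) = _ from funext hF2]
  have bG : eLpNorm (⇑G) (ENNReal.ofReal (q / (q - 1))) volume ≤
      ENNReal.ofReal (Cq * |lam * (c - b / 2)| ^ (1 / 2 - 1 / q)) * eLpNorm (⇑g) (ENNReal.ofReal q) volume := by
    have h := hdq ℝ _ volume inferInstance _ hm2 (⇑(FourierTransform.fourier g : 𝓢(ℝ, ℂ))) _ (mul_ne_zero hlam hc0)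
    rw [← inversion_aux g] at h
    rwa [show (⇑G : ℝ → ℂ) = _ from funext hG2]
  have bB : eLpNorm (Bop1 m φ lam f g) (ENNReal.ofReal r) volume ≤
      ENNReal.ofReal (CR * |lam * (b / 2)| ^ (1 / 2 - 1 / R)) *
        eLpNorm (Bop1 m φ 0 F G) (ENNReal.ofReal R) volume := by
    have hm3 : Measurable (fun w : ℝ × ℝ => w.1 + w.2) := by fun_prop
    have h := hdR (ℝ × ℝ) _ volume inferInstance _ hm3
      (fun w => (((2 * Real.pi) ^ (-(1 : ℝ) / 2) : ℝ) : ℂ) * (m w * FT1 (⇑F) w.1 * FT1 (⇑G) w.2)) _ (mul_ne_zero hlam hb0)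
    have e1 : Bop1 m φ lam f g = (fun x : ℝ => ∫ w : ℝ × ℝ, cexp (I * ((x * (w.1 + w.2) + (lam * (b / 2)) * (w.1 + w.2) ^ 2 : ℝ) : ℂ)) *
        ((((2 * Real.pi) ^ (-(1 : ℝ) / 2) : ℝ) : ℂ) * (m w * FT1 (⇑F) w.1 * FT1 (⇑G) w.2))) := by
      ext x
      rw [Bop1, ← integral_const_mul]
      congr 1; ext w
      rw [hF1, hG1]
      have : cexp (I * ((x * (w.1 + w.2) + lam * φ w : ℝ) : ℂ)) =
          cexp (I * ((x * (w.1 + w.2) + (lam * (b / 2)) * (w.1 + w.2) ^ 2 : ℝ) : ℂ)) *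
          cexp (I * ((lam * (a - b / 2) * w.1 ^ 2 : ℝ) : ℂ)) *
          cexp (I * ((lam * (c - b / 2) * w.2 ^ 2 : ℝ) : ℂ)) := by
        rw [← Complex.exp_add, ← Complex.exp_add, hφ]
        congr 1
        push_cast
        ring
      rw [this]
      ring
    have e2 : Bop1 m φ 0 F G = (fun x : ℝ => ∫ w : ℝ × ℝ, cexp (I * ((x * (w.1 + w.2) : ℝ) : ℂ)) *
        ((((2 * Real.pi) ^ (-(1 : ℝ) / 2) : ℝ) : ℂ) * (m w * FT1 (⇑F) w.1 * FT1 (⇑G) w.2))) := by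
      ext x
      rw [Bop1, ← integral_const_mul]
      congr 1; ext w
      rw [zero_mul, add_zero]
      ring
    rw [e1, e2]
    exact h
  have hT := hC₀ F G
  calc _ ≤ _ := bB
    _ ≤ ENNReal.ofReal (CR * |lam * (b / 2)| ^ (1 / 2 - 1 / R)) *
        (ENNReal.ofReal (max C₀ 0) *
          ((ENNReal.ofReal (Cp * |lam * (a - b / 2)| ^ (1 / 2 - 1 / p)) * eLpNorm (⇑f) (ENNReal.ofReal p) volume) *
          (ENNReal.ofReal (Cq * |lam * (c - b / 2)| ^ (1 / 2 - 1 / q)) * eLpNorm (⇑g) (ENNReal.ofReal q) volume))) := by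
        gcongr
        refine hT.trans ?_
        gcongr
        exact le_max_left _ _
    _ = (ENNReal.ofReal (CR * |lam * (b / 2)| ^ (1 / 2 - 1 / R)) * ENNReal.ofReal (max C₀ 0) *
          (ENNReal.ofReal (Cp * |lam * (a - b / 2)| ^ (1 / 2 - 1 / p)) *
          ENNReal.ofReal (Cq * |lam * (c - b / 2)| ^ (1 / 2 - 1 / q)))) *
          (eLpNorm (⇑f) (ENNReal.ofReal p) volume * eLpNorm (⇑g) (ENNReal.ofReal q) volume) := by ring
    _ = _ := by
        rw [← ENNReal.ofReal_mul (by positivity), ← ENNReal.ofReal_mul (by positivity), ← ENNReal.ofReal_mul (by positivity)]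
        congr 2
        have hlp : 0 < |lam| := abs_pos.2 hlam
        have hex : -(1 : ℝ) / 2 = (1 / 2 - 1 / R) + (1 / 2 - 1 / p) + (1 / 2 - 1 / q) := by
          have : 1 / R = 1 - 1 / r := by rw [hR]; field_simp
          rw [this]; linarith
        rw [hex, Real.rpow_add hlp, Real.rpow_add hlp]
        simp only [abs_mul lam, Real.mul_rpow (abs_nonneg lam) (abs_nonneg _)]
        ring
end
end

section
/- Let φ, m ∈ C_0^∞(ℝ^{2d}) with φ real-valued, and assume that the full 2d×2d Hessian matrix Hess φ is invertible at every point of supp m. Then there exists a constant C such that for all λ ≠ 0 and all Schwartz functions f, g on ℝ^d, ‖B_λ(f,g)‖_{L^∞} ≤ C |λ|^{−d} ‖f‖_{L^1} ‖g‖_{L^1}. -/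
open MeasureTheory Filter Complex SchwartzMap
open scoped RealInnerProductSpace ENNReal

noncomputable section

/-- Euclidean space `ℝ^d`. -/
abbrev E (d : ℕ) : Type := EuclideanSpace ℝ (Fin d)

/-- The Fourier transform `(2π)^{-d/2} ∫ e^{-i x·ξ} f(x) dx`. -/
def FT {d : ℕ} (f : E d → ℂ) (ξ : E d) : ℂ :=
  (((2 * Real.pi) ^ (-(d : ℝ) / 2) : ℝ) : ℂ) *
    ∫ x : E d, Complex.exp (-(Complex.I * ((⟪x, ξ⟫ : ℝ) : ℂ))) * f x

/-- The bilinear oscillatory integral `B_λ(f,g)` with symbol `m` and phase `φ`. -/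
def Bop {d : ℕ} (m : E d × E d → ℂ) (φ : E d × E d → ℝ) (lam : ℝ)
    (f g : 𝓢(E d, ℂ)) (x : E d) : ℂ :=
  (((2 * Real.pi) ^ (-(d : ℝ) / 2) : ℝ) : ℂ) *
    ∫ p : E d × E d,
      Complex.exp (Complex.I * ((⟪x, p.1 + p.2⟫ + lam * φ p : ℝ) : ℂ)) *
        m p * FT (⇑f) p.1 * FT (⇑g) p.2

/-- Standard basis vector of `ℝ^d`. -/
def ev {d : ℕ} (i : Fin d) : E d := EuclideanSpace.single i 1

/-- The direction corresponding to `∂_{η_i}`. -/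
def etaV {d : ℕ} (i : Fin d) : E d × E d := (ev i, 0)

/-- The direction corresponding to `∂_{ξ_i}`. -/
def xiV {d : ℕ} (i : Fin d) : E d × E d := (0, ev i)

/-- Iterated (second) directional derivative: first in direction `u`, then in direction `v`. -/
def D2 {V : Type*} [NormedAddCommGroup V] [NormedSpace ℝ V]
    (φ : V → ℝ) (x u v : V) : ℝ :=
  fderiv ℝ (fun y => fderiv ℝ φ y u) x v

/-- The full `2d × 2d` Hessian matrix of `φ` at `x` in the variables `(η,ξ)`. -/
def hessMat {d : ℕ} (φ : E d × E d → ℝ) (x : E d × E d) :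
    Matrix (Fin d ⊕ Fin d) (Fin d ⊕ Fin d) ℝ :=
  Matrix.of fun i j => D2 φ x (Sum.elim etaV xiV j) (Sum.elim etaV xiV i)

/-- The `d × d` matrix `(A_i B_j φ)_{i,j}` for families of first-order directions `A`, `B`. -/
def derMat {d : ℕ} (φ : E d × E d → ℝ) (x : E d × E d)
    (A B : Fin d → E d × E d) : Matrix (Fin d) (Fin d) ℝ :=
  Matrix.of fun i j => D2 φ x (B j) (A i)

lemma param_aux {H : Type} [NormedAddCommGroup H] [NormedSpace ℝ H] [FiniteDimensional ℝ H]
    (n : ℕ) : ∀ (G : Type) [NormedAddCommGroup G] [NormedSpace ℝ G] [CompleteSpace G]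
    (F : H × ℝ → G), ContDiff ℝ (⊤ : ℕ∞) F →
      ContDiff ℝ n (fun x => ∫ t in (0:ℝ)..1, F (x, t)) := by
  induction n with
  | zero =>
    intro G _ _ _ F hF
    rw [Nat.cast_zero, contDiff_zero]
    have := hF.continuous
    exact intervalIntegral.continuous_parametric_intervalIntegral_of_continuous'
      (f := fun x t => F (x, t)) (by simpa [Function.uncurry_def] using this) 0 1
  | succ n ih =>
    intro G _ _ _ F hF
    rw [Nat.cast_add, Nat.cast_one, contDiff_succ_iff_hasFDerivAt]
    let F' : H × ℝ → (H →L[ℝ] G) := fun p => (fderiv ℝ F p).comp (ContinuousLinearMap.inl ℝ H ℝ)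
    have hF' : ContDiff ℝ (⊤ : ℕ∞) F' := by
      have : ContDiff ℝ (⊤ : ℕ∞) (fderiv ℝ F) := hF.fderiv_right (by simp)
      exact this.clm_comp contDiff_const
    refine ⟨_, ih (H →L[ℝ] G) F' hF', fun x => ?_⟩
    have hc' : Continuous F' := hF'.continuous
    have hc : Continuous F := hF.continuous
    have hcomp : IsCompact (Metric.closedBall x 1 ×ˢ Set.Icc (0:ℝ) 1) :=
      (isCompact_closedBall x 1).prod isCompact_Icc
    obtain ⟨C, hC⟩ := hcomp.exists_bound_of_continuousOn hc'.continuousOn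
    refine intervalIntegral.hasFDerivAt_integral_of_dominated_of_fderiv_le
      (F := fun x t => F (x, t)) (F' := fun x t => F' (x, t)) (bound := fun _ => C)
      (Metric.closedBall_mem_nhds x one_pos) ?_ ?_ ?_ ?_ ?_ ?_
    · exact Eventually.of_forall fun y => Continuous.aestronglyMeasurable (by fun_prop)
    · exact Continuous.intervalIntegrable (by fun_prop) _ _
    · exact Continuous.aestronglyMeasurable (by fun_prop)
    · refine Eventually.of_forall fun t ht y hy => hC (y, t) ⟨hy, ?_⟩
      rw [Set.uIoc_of_le zero_le_one] at ht
      exact ⟨ht.1.le, ht.2⟩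
    · exact intervalIntegrable_const
    · refine Eventually.of_forall fun t ht y hy => ?_
      have h1 : HasFDerivAt F (fderiv ℝ F (y, t)) (y, t) :=
        (hF.differentiable (by simp) _).hasFDerivAt
      exact h1.comp y (hasFDerivAt_prodMk_left y t)

lemma param_smooth {H : Type} [NormedAddCommGroup H] [NormedSpace ℝ H] [FiniteDimensional ℝ H]
    {G : Type} [NormedAddCommGroup G] [NormedSpace ℝ G] [CompleteSpace G]
    (F : H × ℝ → G) (hF : ContDiff ℝ (⊤ : ℕ∞) F) :
      ContDiff ℝ (⊤ : ℕ∞) (fun x => ∫ t in (0:ℝ)..1, F (x, t)) :=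
  contDiff_infty.2 fun n => param_aux n G F hF

/-- The Hadamard lemma with smooth remainder. -/
lemma hadamard {V : Type} [NormedAddCommGroup V] [NormedSpace ℝ V] [FiniteDimensional ℝ V]
    {G : Type} [NormedAddCommGroup G] [NormedSpace ℝ G] [CompleteSpace G]
    (f : V → G) (hf : ContDiff ℝ (⊤ : ℕ∞) f) :
    ∃ h : V × ℝ × V → G, ContDiff ℝ (⊤ : ℕ∞) h ∧
      ∀ c e q, f (c + e • q) = f c + e • h (c, e, q) := by
  have hf' : ContDiff ℝ (⊤ : ℕ∞) (fderiv ℝ f) := hf.fderiv_right (by simp)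
  refine ⟨fun x => ∫ t in (0:ℝ)..1, fderiv ℝ f (x.1 + (t * x.2.1) • x.2.2) x.2.2, ?_, ?_⟩
  · refine param_smooth
      (fun p : (V × ℝ × V) × ℝ => fderiv ℝ f (p.1.1 + (p.2 * p.1.2.1) • p.1.2.2) p.1.2.2) ?_
    have h1 : ContDiff ℝ (⊤ : ℕ∞) (fun p : (V × ℝ × V) × ℝ =>
      (p.1.1 + (p.2 * p.1.2.1) • p.1.2.2)) := by fun_prop
    have h2 : ContDiff ℝ (⊤ : ℕ∞) (fun p : (V × ℝ × V) × ℝ => p.1.2.2) := by fun_prop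
    exact (hf'.comp h1).clm_apply h2
  · intro c e q
    have h1 : ∀ t : ℝ, HasDerivAt (fun t : ℝ => f (c + (t * e) • q))
        (e • fderiv ℝ f (c + (t * e) • q) q) t := by
      intro t
      have h2 : HasDerivAt (fun t : ℝ => c + (t * e) • q) (e • q) t := by
        have := ((hasDerivAt_id t).mul_const e).smul_const q
        simpa using this.const_add c
      have h3 := (hf.differentiable (by simp) (c + (t * e) • q)).hasFDerivAt.comp_hasDerivAt t h2
      rw [map_smul] at h3
      exact h3
    have h4 := intervalIntegral.integral_eq_sub_of_hasDerivAt (a := 0) (b := 1)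
      (fun t _ => h1 t) (by
        apply Continuous.intervalIntegrable
        have := hf'.continuous
        fun_prop)
    rw [intervalIntegral.integral_smul] at h4
    simp only [h4]
    simp

lemma taylor2 {V : Type} [NormedAddCommGroup V] [NormedSpace ℝ V] [FiniteDimensional ℝ V]
    (φ : V → ℝ) (hφ : ContDiff ℝ (⊤ : ℕ∞) φ) :
    ∃ S : V × ℝ × V → ℝ, ContDiff ℝ (⊤ : ℕ∞) S ∧
      ∀ c e q, φ (c + e • q) = φ c + e * fderiv ℝ φ c q + e ^ 2 * S (c, e, q) := by
  have hf' : ContDiff ℝ (⊤ : ℕ∞) (fderiv ℝ φ) := hφ.fderiv_right (by simp)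
  obtain ⟨h, hh, he⟩ := hadamard (fderiv ℝ φ) hf'
  refine ⟨fun x => ∫ t in (0:ℝ)..1, t * h (x.1, t * x.2.1, x.2.2) x.2.2, ?_, ?_⟩
  · refine param_smooth
      (fun p : (V × ℝ × V) × ℝ => p.2 * h (p.1.1, p.2 * p.1.2.1, p.1.2.2) p.1.2.2) ?_
    have h1 : ContDiff ℝ (⊤ : ℕ∞) (fun p : (V × ℝ × V) × ℝ =>
      (p.1.1, p.2 * p.1.2.1, p.1.2.2)) := by fun_prop
    have h2 : ContDiff ℝ (⊤ : ℕ∞) (fun p : (V × ℝ × V) × ℝ => p.1.2.2) := by fun_prop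
    exact contDiff_snd.mul ((hh.comp h1).clm_apply h2)
  · intro c e q
    have h1 : ∀ t : ℝ, HasDerivAt (fun t : ℝ => φ (c + (t * e) • q))
        (e * fderiv ℝ φ c q + e ^ 2 * (t * h (c, t * e, q) q)) t := by
      intro t
      have h2 : HasDerivAt (fun t : ℝ => c + (t * e) • q) (e • q) t := by
        have := ((hasDerivAt_id t).mul_const e).smul_const q
        simpa using this.const_add c
      have h3 := (hφ.differentiable (by simp) (c + (t * e) • q)).hasFDerivAt.comp_hasDerivAt t h2
      rw [he] at h3
      refine HasDerivAt.congr_deriv h3 ?_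
      simp
      ring
    have hc := hh.continuous
    have h4 := intervalIntegral.integral_eq_sub_of_hasDerivAt (a := 0) (b := 1)
      (fun t _ => h1 t) (by
        apply Continuous.intervalIntegrable
        fun_prop)
    rw [intervalIntegral.integral_add (by simp) (by
        apply Continuous.intervalIntegrable
        fun_prop), intervalIntegral.integral_const_mul] at h4
    simp at h4
    simp only
    linarith

lemma decay_pow {Θ V : Type} [NormedAddCommGroup Θ] [NormedSpace ℝ Θ]
    [NormedAddCommGroup V] [NormedSpace ℝ V] [FiniteDimensional ℝ V]
    [MeasurableSpace V] [BorelSpace V] (μ : Measure V) [μ.IsAddHaarMeasure]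
    (B : Θ × V → ℂ) (hB : ContDiff ℝ (⊤ : ℕ∞) B) (T : Set Θ) (hT : IsCompact T)
    (Q : Set V) (hQ : IsCompact Q) (hBQ : ∀ θ q, q ∉ Q → B (θ, q) = 0) (k : ℕ) :
    ∃ C : ℝ, ∀ θ ∈ T, ∀ ζ : V →L[ℝ] ℝ,
      ‖ζ‖ ^ k * ‖∫ q, Complex.exp (Complex.I * (ζ q : ℝ)) * B (θ, q) ∂μ‖ ≤ C := by
  have hbd : ∀ j : ℕ, ∃ M : ℝ, ∀ θ ∈ T, ∀ q,
      ‖iteratedFDeriv ℝ j (fun q => B (θ, q)) q‖ ≤ Q.indicator (fun _ => M) q := by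
    intro j
    have hcont : Continuous (iteratedFDeriv ℝ j B) :=
      hB.continuous_iteratedFDeriv (by exact_mod_cast le_top)
    obtain ⟨M, hM⟩ := (hT.prod hQ).exists_bound_of_continuousOn hcont.continuousOn
    refine ⟨M * ‖ContinuousLinearMap.inr ℝ Θ V‖ ^ j, fun θ hθ q => ?_⟩
    by_cases hq : q ∈ Q
    · rw [Set.indicator_of_mem hq]
      have h1 : (fun q => B (θ, q)) =
          (fun z => B ((θ, 0) + z)) ∘ (ContinuousLinearMap.inr ℝ Θ V) := by
        ext q; simp
      have h2 : ContDiff ℝ (⊤ : ℕ∞) (fun z => B ((θ, 0) + z)) :=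
        hB.comp (contDiff_const.add contDiff_id)
      rw [h1, ContinuousLinearMap.iteratedFDeriv_comp_right _ h2 _ (by exact_mod_cast le_top),
        iteratedFDeriv_comp_add_left]
      refine (ContinuousMultilinearMap.norm_compContinuousLinearMap_le _ _).trans ?_
      simp only [Finset.prod_const, Finset.card_univ, Fintype.card_fin]
      gcongr
      have := hM (θ, q) ⟨hθ, hq⟩
      simpa using this
    · rw [Set.indicator_of_notMem hq]
      have : q ∉ tsupport (fun q => B (θ, q)) := by
        intro h
        apply hq
        refine closure_minimal ?_ hQ.isClosed h
        intro x hx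
        by_contra hxQ
        exact hx (hBQ θ x hxQ)
      have := fun h => this (support_iteratedFDeriv_subset (𝕜 := ℝ) j h)
      rw [Function.notMem_support.1 this]; simp
  choose M hM using hbd
  refine ⟨(4 * Real.pi) ^ k * (2 ^ k * ∑ p ∈ Finset.range (0 + 1) ×ˢ Finset.range (k + 1),
    ∫ q, Q.indicator (fun _ => M p.2) q ∂μ), fun θ hθ ζ => ?_⟩
  set X := ‖∫ q, Complex.exp (Complex.I * (ζ q : ℝ)) * B (θ, q) ∂μ‖ with hX
  have hbθ : ContDiff ℝ (⊤ : ℕ∞) (fun q => B (θ, q)) := by fun_prop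
  have hindint : ∀ j, Integrable (Q.indicator (fun _ => M j)) μ := fun j =>
    (integrable_indicator_iff hQ.measurableSet).2 (integrableOn_const hQ.measure_lt_top.ne)
  have hint : ∀ j : ℕ, Integrable (fun q => ‖iteratedFDeriv ℝ j (fun q => B (θ, q)) q‖) μ := by
    intro j
    refine (hindint j).mono' ?_ (Eventually.of_forall fun q => by simpa using hM j θ hθ q)
    exact (hbθ.continuous_iteratedFDeriv (by exact_mod_cast le_top)).norm.aestronglyMeasurable
  have key := fun v => VectorFourier.pow_mul_norm_iteratedFDeriv_fourierIntegral_le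
    (V := V) (W := V →L[ℝ] ℝ) (μ := μ) (K := 0) (N := ⊤)
    (ContinuousLinearMap.apply ℝ ℝ) hbθ (fun k' n hk' hn => by
      have : k' = 0 := by simpa using hk'
      subst this
      simpa using hint n) (k := 0) (n := k) le_rfl le_top v (-(2 * Real.pi)⁻¹ • ζ)
  have hF : VectorFourier.fourierIntegral Real.fourierChar μ
      ((ContinuousLinearMap.apply ℝ ℝ : V →L[ℝ] _).toLinearMap₁₂) (fun q => B (θ, q))
      (-(2 * Real.pi)⁻¹ • ζ) = ∫ q, Complex.exp (Complex.I * (ζ q : ℝ)) * B (θ, q) ∂μ := by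
    rw [VectorFourier.fourierIntegral]
    congr 1
    ext q
    rw [Circle.smul_def, Real.fourierChar_apply]
    rw [smul_eq_mul]
    congr 2
    change ((2 * Real.pi * (-((-(2 * Real.pi)⁻¹ • ζ) q)) : ℝ) : ℂ) * I = _
    have := Real.pi_ne_zero
    simp
    field_simp
  simp only [norm_iteratedFDeriv_zero, hF, ← hX] at key
  obtain ⟨v, hv1, hv2⟩ : ∃ v : V, ‖v‖ ≤ 1 ∧ ‖ζ‖ / 2 ≤ |ζ v| := by
    by_cases hz : ζ = 0
    · exact ⟨0, by simp, by simp [hz]⟩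
    · have : ‖ζ‖ / 2 < ‖ζ‖ := half_lt_self (norm_pos_iff.2 hz)
      obtain ⟨v, h1, h2⟩ := ContinuousLinearMap.exists_lt_apply_of_lt_opNorm ζ this
      exact ⟨v, h1.le, h2.le⟩
  have hX0 : 0 ≤ X := norm_nonneg _
  have hpi := Real.pi_pos
  have h1 : ‖ζ‖ ≤ (4 * Real.pi) *
      |(ContinuousLinearMap.apply ℝ ℝ : V →L[ℝ] _) v (-(2 * Real.pi)⁻¹ • ζ)| := by
    have : (ContinuousLinearMap.apply ℝ ℝ : V →L[ℝ] _) v (-(2 * Real.pi)⁻¹ • ζ) =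
      -(2 * Real.pi)⁻¹ * ζ v := by simp
    rw [this, abs_mul, abs_neg, abs_of_pos (by positivity)]
    field_simp
    linarith
  calc ‖ζ‖ ^ k * X ≤ ((4 * Real.pi) *
      |(ContinuousLinearMap.apply ℝ ℝ : V →L[ℝ] _) v (-(2 * Real.pi)⁻¹ • ζ)|) ^ k * X := by gcongr
    _ = (4 * Real.pi) ^ k *
      (|(ContinuousLinearMap.apply ℝ ℝ : V →L[ℝ] _) v (-(2 * Real.pi)⁻¹ • ζ)| ^ k * X) := by ring
    _ ≤ _ := by
      refine mul_le_mul_of_nonneg_left ?_ (by positivity)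
      refine (key v).trans ?_
      have h3 : ‖v‖ ^ k ≤ 1 := pow_le_one₀ (norm_nonneg _) hv1
      have h2 : ∑ p ∈ Finset.range (0 + 1) ×ˢ Finset.range (k + 1),
          ∫ v, ‖v‖ ^ p.1 * ‖iteratedFDeriv ℝ p.2 (fun q => B (θ, q)) v‖ ∂μ ≤
          ∑ p ∈ Finset.range (0 + 1) ×ˢ Finset.range (k + 1),
            ∫ q, Q.indicator (fun _ => M p.2) q ∂μ := by
        refine Finset.sum_le_sum fun p hp => ?_
        have hp0 : p.1 = 0 := by
          have := (Finset.mem_product.1 hp).1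
          simpa using this
        rw [hp0]
        simp only [pow_zero, one_mul]
        exact integral_mono (hint _) (hindint _) (fun q => hM _ θ hθ q)
      have h4 : 0 ≤ ∑ p ∈ Finset.range (0 + 1) ×ˢ Finset.range (k + 1),
          ∫ v, ‖v‖ ^ p.1 * ‖iteratedFDeriv ℝ p.2 (fun q => B (θ, q)) v‖ ∂μ :=
        Finset.sum_nonneg fun p _ => integral_nonneg fun _ => by positivity
      simp only [pow_zero, mul_one, Nat.cast_zero, mul_zero, zero_add] at h2 h4 ⊢
      refine (mul_le_mul_of_nonneg_right (mul_le_mul_of_nonneg_right h3 (by positivity)) h4).trans ?_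
      rw [one_mul]
      exact mul_le_mul_of_nonneg_left h2 (by positivity)

lemma decay {Θ V : Type} [NormedAddCommGroup Θ] [NormedSpace ℝ Θ]
    [NormedAddCommGroup V] [NormedSpace ℝ V] [FiniteDimensional ℝ V]
    [MeasurableSpace V] [BorelSpace V] (μ : Measure V) [μ.IsAddHaarMeasure]
    (B : Θ × V → ℂ) (hB : ContDiff ℝ (⊤ : ℕ∞) B) (T : Set Θ) (hT : IsCompact T)
    (Q : Set V) (hQ : IsCompact Q) (hBQ : ∀ θ q, q ∉ Q → B (θ, q) = 0) (N : ℕ) :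
    ∃ C : ℝ, 0 ≤ C ∧ ∀ θ ∈ T, ∀ ζ : V →L[ℝ] ℝ,
      ‖∫ q, Complex.exp (Complex.I * (ζ q : ℝ)) * B (θ, q) ∂μ‖ ≤ C * ((1 + ‖ζ‖) ^ N)⁻¹ := by
  obtain ⟨C₀, h0⟩ := decay_pow μ B hB T hT Q hQ hBQ 0
  obtain ⟨C₁, h1⟩ := decay_pow μ B hB T hT Q hQ hBQ N
  refine ⟨2 ^ (N - 1) * (|C₀| + |C₁|), by positivity, fun θ hθ ζ => ?_⟩
  have h0 := h0 θ hθ ζ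
  have h1 := h1 θ hθ ζ
  set X := ‖∫ q, Complex.exp (Complex.I * (ζ q : ℝ)) * B (θ, q) ∂μ‖
  have hX0 : 0 ≤ X := norm_nonneg _
  rw [← div_eq_mul_inv, le_div_iff₀ (by positivity)]
  have h2 := add_pow_le zero_le_one (norm_nonneg ζ) N
  calc X * (1 + ‖ζ‖) ^ N ≤ X * (2 ^ (N - 1) * (1 ^ N + ‖ζ‖ ^ N)) := by gcongr
    _ = 2 ^ (N - 1) * (‖ζ‖ ^ 0 * X + ‖ζ‖ ^ N * X) := by rw [one_pow, pow_zero]; ring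
    _ ≤ _ := by
      gcongr
      · exact h0.trans (le_abs_self _)
      · exact h1.trans (le_abs_self _)
open Topology Module

lemma scaled_int {V : Type} [NormedAddCommGroup V] [NormedSpace ℝ V] [FiniteDimensional ℝ V]
    [MeasurableSpace V] [BorelSpace V] (μ : Measure V) [μ.IsAddHaarMeasure] (N : ℕ)
    (hN : finrank ℝ V < N) : ∃ C : ℝ, 0 ≤ C ∧ ∀ R : ℝ, 0 < R → ∀ c₀ : V,
      ∫⁻ c, ENNReal.ofReal (((1 + R * ‖c - c₀‖) ^ N)⁻¹) ∂μ ≤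
        ENNReal.ofReal (C * (R ^ finrank ℝ V)⁻¹) := by
  have hI : Integrable (fun x : V => ((1 + ‖x‖) ^ N)⁻¹) μ := by
    have := integrable_one_add_norm (E := V) (μ := μ) (r := N) (by exact_mod_cast hN)
    refine this.congr (Eventually.of_forall fun x => ?_)
    have h : 0 < 1 + ‖x‖ := by positivity
    simp [Real.rpow_neg h.le, Real.rpow_natCast]
  refine ⟨∫ x, ((1 + ‖x‖) ^ N)⁻¹ ∂μ, integral_nonneg fun x => by positivity, fun R hR c₀ => ?_⟩
  rw [lintegral_sub_right_eq_self (μ := μ) (fun c => ENNReal.ofReal (((1 + R * ‖c‖) ^ N)⁻¹)) c₀]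
  have h1 : (fun c : V => ((1 + R * ‖c‖) ^ N)⁻¹) = fun c => (fun x : V => ((1 + ‖x‖) ^ N)⁻¹) (R • c) := by
    ext c; simp [norm_smul, abs_of_pos hR]
  have h2 : Integrable (fun c : V => ((1 + R * ‖c‖) ^ N)⁻¹) μ := by
    rw [h1]; exact hI.comp_smul hR.ne'
  rw [← ofReal_integral_eq_lintegral_ofReal h2 (Eventually.of_forall fun x => by positivity), h1,
    Measure.integral_comp_smul_of_nonneg μ (fun x : V => ((1 + ‖x‖) ^ N)⁻¹) R (hR := hR.le),
    smul_eq_mul, mul_comm]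

lemma nearby {V W : Type} [NormedAddCommGroup V] [NormedSpace ℝ V] [FiniteDimensional ℝ V]
    [NormedAddCommGroup W] [NormedSpace ℝ W]
    [MeasurableSpace V] [BorelSpace V] (μ : Measure V) [μ.IsAddHaarMeasure] (N : ℕ)
    (hN : finrank ℝ V < N) (G : V → W) (hG : ContDiff ℝ (⊤ : ℕ∞) G) (K : Set V) (hK : IsCompact K)
    (hinj : ∀ p ∈ K, Function.Injective (fderiv ℝ G p)) :
    ∃ U ∈ 𝓝ˢ K, ∃ C : ℝ, 0 ≤ C ∧ ∀ R : ℝ, 0 < R → ∀ w : W,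
      ∫⁻ c in U, ENNReal.ofReal (((1 + R * ‖G c + w‖) ^ N)⁻¹) ∂μ ≤
        ENNReal.ofReal (C * (R ^ finrank ℝ V)⁻¹) := by
  refine hK.induction_on (p := fun K => ∃ U ∈ 𝓝ˢ K, ∃ C : ℝ, 0 ≤ C ∧ ∀ R : ℝ, 0 < R → ∀ w : W,
      ∫⁻ c in U, ENNReal.ofReal (((1 + R * ‖G c + w‖) ^ N)⁻¹) ∂μ ≤
        ENNReal.ofReal (C * (R ^ finrank ℝ V)⁻¹)) ?_ ?_ ?_ ?_
  · exact ⟨∅, by simp, 0, le_rfl, by simp⟩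
  · rintro s t hst ⟨U, hU, h⟩
    exact ⟨U, nhdsSet_mono hst hU, h⟩
  · rintro s t ⟨U, hU, C, hC, h⟩ ⟨U', hU', C', hC', h'⟩
    refine ⟨U ∪ U', ?_, C + C', by positivity, fun R hR w => ?_⟩
    · exact union_mem_nhdsSet hU hU'
    · refine (lintegral_union_le _ _ _).trans ?_
      rw [add_mul, ENNReal.ofReal_add (by positivity) (by positivity)]
      exact add_le_add (h R hR w) (h' R hR w)
  · intro x hx
    obtain ⟨C, hC, hsc⟩ := scaled_int μ N hN
    obtain ⟨k, hk, hanti⟩ := LinearMap.exists_antilipschitzWith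
      (fderiv ℝ G x : V →ₗ[ℝ] W) (LinearMap.ker_eq_bot.2 (hinj x hx))
    have hstrict : HasStrictFDerivAt G (fderiv ℝ G x) x :=
      hG.contDiffAt.hasStrictFDerivAt (by simp)
    set κ : ℝ := (k : ℝ)⁻¹ with hκ
    have hk' : 0 < κ := by positivity
    have hA : ∀ v, κ * ‖v‖ ≤ ‖fderiv ℝ G x v‖ := by
      intro v
      have := hanti.le_mul_norm_sub v 0
      simp only [map_zero, add_zero, norm_neg] at this
      rw [hκ, inv_mul_le_iff₀ (by exact_mod_cast hk)]
      exact this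
    have hlit := hstrict.isLittleO.def (half_pos hk')
    rw [nhds_prod_eq] at hlit
    obtain ⟨s, hs, hss⟩ := (Filter.eventually_prod_self_iff (r := fun a b =>
      ‖G a - G b - (fderiv ℝ G x) (a - b)‖ ≤ κ / 2 * ‖a - b‖)).1 hlit
    obtain ⟨r, hr, hrs⟩ := Metric.nhds_basis_closedBall.mem_iff.1 hs
    have hlow : ∀ a ∈ Metric.closedBall x r, ∀ b ∈ Metric.closedBall x r,
        κ / 2 * ‖a - b‖ ≤ ‖G a - G b‖ := by
      intro a ha b hb
      have h1 := hss a (hrs ha) b (hrs hb)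
      have h2 := hA (a - b)
      have h3 := norm_sub_norm_le (fderiv ℝ G x (a - b)) (G a - G b)
      rw [norm_sub_rev (fderiv ℝ G x (a - b)) (G a - G b)] at h3
      linarith
    refine ⟨Metric.ball x r, mem_nhdsWithin_of_mem_nhds (Metric.ball_mem_nhds x hr),
      Metric.closedBall x r, ?_, C * ((κ / 4) ^ finrank ℝ V)⁻¹, by positivity, fun R hR w => ?_⟩
    · exact mem_of_superset (Metric.isOpen_ball.mem_nhdsSet_self) Metric.ball_subset_closedBall
    · obtain ⟨c₀, hc₀, hmin⟩ := (isCompact_closedBall x r).exists_isMinOn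
        (Metric.nonempty_closedBall.2 hr.le)
        ((hG.continuous.add continuous_const).norm.continuousOn (f := fun c => ‖G c + w‖))
      calc ∫⁻ c in Metric.closedBall x r, ENNReal.ofReal (((1 + R * ‖G c + w‖) ^ N)⁻¹) ∂μ
          ≤ ∫⁻ c in Metric.closedBall x r,
            ENNReal.ofReal (((1 + (R * (κ / 4)) * ‖c - c₀‖) ^ N)⁻¹) ∂μ := by
            refine setLIntegral_mono' Metric.isClosed_closedBall.measurableSet fun c hc => ?_
            have h1 : ‖G c₀ + w‖ ≤ ‖G c + w‖ := hmin hc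
            have h2 := hlow c hc c₀ hc₀
            have h3 : ‖G c - G c₀‖ ≤ ‖G c + w‖ + ‖G c₀ + w‖ := by
              rw [← add_sub_add_right_eq_sub _ _ w]; exact norm_sub_le _ _
            have h4 : κ / 4 * ‖c - c₀‖ ≤ ‖G c + w‖ := by linarith
            rw [mul_assoc]
            gcongr
        _ ≤ ∫⁻ c, ENNReal.ofReal (((1 + (R * (κ / 4)) * ‖c - c₀‖) ^ N)⁻¹) ∂μ :=
            setLIntegral_le_lintegral _ _
        _ ≤ _ := hsc _ (by positivity) c₀
        _ = _ := by congr 1; rw [mul_pow, mul_inv]; ring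

lemma osc {V : Type} [NormedAddCommGroup V] [NormedSpace ℝ V] [FiniteDimensional ℝ V]
    [MeasurableSpace V] [BorelSpace V] (μ : Measure V) [μ.IsAddHaarMeasure]
    (φ : V → ℝ) (m : V → ℂ)
    (hφs : ContDiff ℝ (⊤ : ℕ∞) φ) (hms : ContDiff ℝ (⊤ : ℕ∞) m) (hmc : HasCompactSupport m)
    (hinj : ∀ p ∈ tsupport m, Function.Injective (fderiv ℝ (fderiv ℝ φ) p)) :
    ∃ C : ℝ, 0 ≤ C ∧ ∀ lam : ℝ, lam ≠ 0 → ∀ ℓ : V →L[ℝ] ℝ,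
      ‖∫ p, Complex.exp (Complex.I * ((ℓ p + lam * φ p : ℝ) : ℂ)) * m p ∂μ‖ ≤
        C * ((√|lam|) ^ finrank ℝ V)⁻¹ := by
  set n := finrank ℝ V with hn
  have hG : ContDiff ℝ (⊤ : ℕ∞) (fderiv ℝ φ) := hφs.fderiv_right (by simp)
  obtain ⟨U, hU, C₁, hC₁, hloc⟩ := nearby μ (n + 1) (by omega) (fderiv ℝ φ) hG (tsupport m) hmc hinj
  obtain ⟨O, hO, hKO, hOU⟩ := mem_nhdsSet_iff_exists.1 hU
  obtain ⟨δ, hδ, hδO⟩ := IsCompact.exists_cthickening_subset_open hmc hO hKO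
  have hmc' : IsCompact (tsupport m) := hmc
  set K := Metric.cthickening δ (tsupport m) with hK
  have hKc : IsCompact K := hmc'.cthickening
  let bump : ContDiffBump (0 : V) := ⟨δ / 2, δ, by positivity, by linarith⟩
  set χ : V → ℝ := bump.normed μ with hχ
  have hχs : ContDiff ℝ (⊤ : ℕ∞) χ := bump.contDiff_normed
  have hχ1 : ∫ q, χ q ∂μ = 1 := bump.integral_normed
  have hχ0 : ∀ q, q ∉ Metric.closedBall (0 : V) δ → χ q = 0 := by
    intro q hq
    have : q ∉ Function.support χ := by
      rw [hχ, bump.support_normed_eq]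
      exact fun h => hq (Metric.ball_subset_closedBall h)
    exact Function.notMem_support.1 this
  obtain ⟨S, hS, hST⟩ := taylor2 φ hφs
  let B : (V × ℝ × ℝ) × V → ℂ := fun z => (χ z.2 : ℂ) * m (z.1.1 + z.1.2.1 • z.2) *
    Complex.exp (Complex.I * ((z.1.2.2 * S (z.1.1, z.1.2.1, z.2) : ℝ) : ℂ))
  have hBs : ContDiff ℝ (⊤ : ℕ∞) B := by
    have h1 : ContDiff ℝ (⊤ : ℕ∞) (fun z : (V × ℝ × ℝ) × V => (χ z.2 : ℂ)) :=
      Complex.ofRealCLM.contDiff.comp (hχs.comp contDiff_snd)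
    have h2 : ContDiff ℝ (⊤ : ℕ∞) (fun z : (V × ℝ × ℝ) × V => m (z.1.1 + z.1.2.1 • z.2)) :=
      hms.comp (by fun_prop)
    have h3 : ContDiff ℝ (⊤ : ℕ∞) (fun z : (V × ℝ × ℝ) × V =>
        z.1.2.2 * S (z.1.1, z.1.2.1, z.2)) :=
      ContDiff.mul (by fun_prop) (hS.comp (by fun_prop))
    exact (h1.mul h2).mul ((contDiff_const.mul (Complex.ofRealCLM.contDiff.comp h3)).cexp)
  obtain ⟨C₂, hC₂, hdec⟩ := decay μ B hBs (K ×ˢ Set.Icc (0:ℝ) 1 ×ˢ Set.Icc (-1 : ℝ) 1)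
    (hKc.prod (isCompact_Icc.prod isCompact_Icc)) (Metric.closedBall 0 δ)
    (isCompact_closedBall 0 δ) (fun θ q hq => by simp [B, hχ0 q hq]) (n + 1)
  have hmint : Integrable m μ := hms.continuous.integrable_of_hasCompactSupport hmc
  have hexp : ∀ r : ℝ, ‖Complex.exp (Complex.I * (r : ℂ))‖ = 1 := fun r => by
    rw [mul_comm]; exact Complex.norm_exp_ofReal_mul_I r
  refine ⟨(∫ p, ‖m p‖ ∂μ) + C₂ * C₁, by positivity, fun lam hlam ℓ => ?_⟩
  have hlam' : 0 < |lam| := abs_pos.2 hlam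
  set R := √|lam| with hR
  have hRpos : 0 < R := Real.sqrt_pos.2 hlam'
  have hRsq : R ^ 2 = |lam| := Real.sq_sqrt hlam'.le
  set F : V → ℂ := fun p => Complex.exp (Complex.I * ((ℓ p + lam * φ p : ℝ) : ℂ)) * m p with hF
  rcases lt_or_ge (|lam|) 1 with hsmall | hbig
  · have h1 : ‖∫ p, F p ∂μ‖ ≤ ∫ p, ‖m p‖ ∂μ := by
      refine (norm_integral_le_integral_norm _).trans (le_of_eq ?_)
      congr 1; ext p
      rw [hF]; simp only [norm_mul, hexp, one_mul]
    have h2 : 1 ≤ (R ^ n)⁻¹ := by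
      rw [one_le_inv₀ (by positivity)]
      exact pow_le_one₀ hRpos.le (Real.sqrt_le_one.2 hsmall.le)
    have h3 : 0 ≤ ∫ p, ‖m p‖ ∂μ := by positivity
    have h4 : 0 ≤ C₂ * C₁ := by positivity
    calc ‖∫ p, F p ∂μ‖ ≤ ((∫ p, ‖m p‖ ∂μ) + C₂ * C₁) * 1 := by linarith
      _ ≤ _ := by gcongr
  have hR1 : 1 ≤ R := Real.one_le_sqrt.2 hbig
  set e := R⁻¹ with he
  have he0 : 0 < e := by positivity
  have he1 : e ≤ 1 := inv_le_one_of_one_le₀ hR1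
  set s := lam * e ^ 2 with hs
  have hsabs : |s| = 1 := by
    rw [hs, abs_mul, abs_of_pos (by positivity : 0 < e ^ 2), ← hRsq, he]
    field_simp
  have hFc : Continuous F := by
    have := hφs.continuous
    have := hms.continuous
    fun_prop
  have hFm : ∀ c q, c ∉ K → q ∈ Metric.closedBall (0:V) δ → m (c + e • q) = 0 := by
    intro c q hc hq
    by_contra h
    apply hc
    have h1 : c + e • q ∈ tsupport m := subset_tsupport m h
    refine Metric.mem_cthickening_of_dist_le c (c + e • q) δ _ h1 ?_
    rw [dist_eq_norm]
    simp only [sub_add_cancel_left, norm_neg, norm_smul, Real.norm_eq_abs, abs_of_pos he0]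
    have : ‖q‖ ≤ δ := by simpa using hq
    nlinarith [norm_nonneg q]
  have hprod0 : ∀ c q, c ∉ K → (χ q : ℂ) * F (c + e • q) = 0 := by
    intro c q hc
    by_cases hq : q ∈ Metric.closedBall (0:V) δ
    · simp [hF, hFm c q hc hq]
    · simp [hχ0 q hq]
  have hint : Integrable (fun z : V × V => (χ z.2 : ℂ) * F (z.1 + e • z.2)) (μ.prod μ) := by
    refine Continuous.integrable_of_hasCompactSupport ?_ ?_
    · have := hχs.continuous
      fun_prop
    · refine HasCompactSupport.intro (hKc.prod (isCompact_closedBall (0:V) δ)) fun z hz => ?_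
      by_cases h : z.1 ∈ K
      · have : z.2 ∉ Metric.closedBall (0:V) δ := fun h' => hz ⟨h, h'⟩
        simp [hχ0 _ this]
      · exact hprod0 _ _ h
  have hswap : ∫ p, F p ∂μ = ∫ c, ∫ q, (χ q : ℂ) * F (c + e • q) ∂μ ∂μ := by
    rw [integral_integral_swap hint]
    have : ∀ q, ∫ c, (χ q : ℂ) * F (c + e • q) ∂μ = (χ q : ℂ) * ∫ p, F p ∂μ := by
      intro q
      rw [integral_const_mul, integral_add_right_eq_self F]
    simp_rw [this]
    rw [integral_mul_const, integral_complex_ofReal, hχ1]; simp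
  have hJ : ∀ c, ‖∫ q, (χ q : ℂ) * F (c + e • q) ∂μ‖ₑ ≤ K.indicator (fun c =>
      ENNReal.ofReal (C₂ * ((1 + R * ‖fderiv ℝ φ c + lam⁻¹ • ℓ‖) ^ (n + 1))⁻¹)) c := by
    intro c
    by_cases hc : c ∈ K
    · rw [Set.indicator_of_mem hc, ← ofReal_norm]
      apply ENNReal.ofReal_le_ofReal
      set ζ : V →L[ℝ] ℝ := (lam * e) • (fderiv ℝ φ c + lam⁻¹ • ℓ) with hζ
      have hζn : ‖ζ‖ = R * ‖fderiv ℝ φ c + lam⁻¹ • ℓ‖ := by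
        rw [hζ, norm_smul, Real.norm_eq_abs, abs_mul, abs_of_pos he0, ← hRsq, he]
        field_simp
      have h1 := hdec (c, e, s) ⟨hc, ⟨he0.le, he1⟩, abs_le.1 hsabs.le⟩ ζ
      rw [hζn] at h1
      refine le_trans (le_of_eq ?_) h1
      have h2 : ∀ q, (χ q : ℂ) * F (c + e • q) =
          Complex.exp (Complex.I * ((ℓ c + lam * φ c : ℝ) : ℂ)) *
            (Complex.exp (Complex.I * (ζ q : ℝ)) * B ((c, e, s), q)) := by
        intro q
        have h3 : Complex.exp (Complex.I * ((ℓ (c + e • q) + lam * φ (c + e • q) : ℝ) : ℂ)) =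
            Complex.exp (Complex.I * ((ℓ c + lam * φ c : ℝ) : ℂ)) *
            (Complex.exp (Complex.I * (ζ q : ℝ)) *
              Complex.exp (Complex.I * ((s * S (c, e, q) : ℝ) : ℂ))) := by
          rw [← Complex.exp_add, ← Complex.exp_add, ← mul_add, ← mul_add, ← Complex.ofReal_add,
            ← Complex.ofReal_add]
          congr 3
          rw [hST, hζ, hs]
          simp only [map_add, map_smul, smul_eq_mul, _root_.smul_apply, _root_.add_apply]
          field_simp
          ring
        simp only [hF, B]
        rw [h3]; ring
      simp_rw [h2]
      rw [integral_const_mul, norm_mul, hexp, one_mul]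
    · rw [Set.indicator_of_notMem hc]
      simp [hprod0 c _ hc]
  have hfin : ‖∫ p, F p ∂μ‖ₑ ≤ ENNReal.ofReal (C₂ * C₁ * (R ^ n)⁻¹) := by
    rw [hswap]
    calc _ ≤ ∫⁻ c, ‖∫ q, (χ q : ℂ) * F (c + e • q) ∂μ‖ₑ ∂μ := enorm_integral_le_lintegral_enorm _
      _ ≤ ∫⁻ c, K.indicator (fun c =>
        ENNReal.ofReal (C₂ * ((1 + R * ‖fderiv ℝ φ c + lam⁻¹ • ℓ‖) ^ (n + 1))⁻¹)) c ∂μ :=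
          lintegral_mono hJ
      _ ≤ ∫⁻ c in K,
        ENNReal.ofReal (C₂ * ((1 + R * ‖fderiv ℝ φ c + lam⁻¹ • ℓ‖) ^ (n + 1))⁻¹) ∂μ :=
          lintegral_indicator_le _ _
      _ ≤ ∫⁻ c in U,
        ENNReal.ofReal (C₂ * ((1 + R * ‖fderiv ℝ φ c + lam⁻¹ • ℓ‖) ^ (n + 1))⁻¹) ∂μ :=
          lintegral_mono_set (hδO.trans hOU)
      _ = ENNReal.ofReal C₂ * ∫⁻ c in U,
        ENNReal.ofReal (((1 + R * ‖fderiv ℝ φ c + lam⁻¹ • ℓ‖) ^ (n + 1))⁻¹) ∂μ := by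
          simp_rw [ENNReal.ofReal_mul hC₂]
          rw [lintegral_const_mul' _ _ ENNReal.ofReal_ne_top]
      _ ≤ ENNReal.ofReal C₂ * ENNReal.ofReal (C₁ * (R ^ n)⁻¹) := by
          gcongr
          exact hloc R hRpos _
      _ = _ := by rw [← ENNReal.ofReal_mul hC₂, mul_assoc]
  rw [← ofReal_norm, ENNReal.ofReal_le_ofReal_iff (by positivity)] at hfin
  refine hfin.trans ?_
  have : 0 ≤ ∫ p, ‖m p‖ ∂μ := by positivity
  gcongr
  linarith

lemma hess_inj {d : ℕ} (φ : E d × E d → ℝ) (hφs : ContDiff ℝ (⊤ : ℕ∞) φ) (p : E d × E d)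
    (h : (hessMat φ p).det ≠ 0) : Function.Injective (fderiv ℝ (fderiv ℝ φ) p) := by
  rw [injective_iff_map_eq_zero]
  intro v hv
  have hG : ContDiff ℝ (⊤ : ℕ∞) (fderiv ℝ φ) := hφs.fderiv_right (by simp)
  have hent : ∀ u w, D2 φ p u w = fderiv ℝ (fderiv ℝ φ) p w u := by
    intro u w
    have h1 : HasFDerivAt (fderiv ℝ φ) (fderiv ℝ (fderiv ℝ φ) p) p :=
      (hG.differentiable (by simp) p).hasFDerivAt
    have h2 := h1.clm_apply (hasFDerivAt_const u p)
    rw [D2, h2.fderiv]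
    simp
  let b : Fin d ⊕ Fin d → E d × E d := Sum.elim etaV xiV
  let a : Fin d ⊕ Fin d → ℝ := Sum.elim (fun i => v.1 i) (fun i => v.2 i)
  have hva : v = ∑ i, a i • b i := by
    rw [Fintype.sum_sum_type]
    refine Prod.ext ?_ ?_
    · ext j
      simp [a, b, etaV, xiV, ev, Prod.fst_sum, Pi.single_apply]
    · ext j
      simp [a, b, etaV, xiV, ev, Prod.snd_sum, Pi.single_apply]
  have hz : Matrix.vecMul a (hessMat φ p) = 0 := by
    ext j
    have h3 : fderiv ℝ (fderiv ℝ φ) p v (b j) = 0 := by rw [hv]; simp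
    rw [hva, map_sum] at h3
    simpa [Matrix.vecMul, dotProduct, hessMat, hent, b] using h3
  have ha := Matrix.eq_zero_of_vecMul_eq_zero h hz
  rw [hva, ha]; simp

lemma Bop_eq {d : ℕ} (φ : E d × E d → ℝ) (m : E d × E d → ℂ)
    (hφs : Continuous φ) (hms : Continuous m) (hmc : HasCompactSupport m)
    (lam : ℝ) (f g : 𝓢(E d, ℂ)) (x : E d) :
    Bop m φ lam f g x = (((2 * Real.pi) ^ (-(d : ℝ) / 2) : ℝ) : ℂ) ^ 3 *
      ∫ z : E d × E d, (f z.1 * g z.2) * ∫ p : E d × E d,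
        Complex.exp (Complex.I * ((((innerSL ℝ (x - z.1)).comp (ContinuousLinearMap.fst ℝ (E d) (E d))
          + (innerSL ℝ (x - z.2)).comp (ContinuousLinearMap.snd ℝ (E d) (E d))) p
          + lam * φ p : ℝ) : ℂ)) * m p := by
  set A : ℂ := (((2 * Real.pi) ^ (-(d : ℝ) / 2) : ℝ) : ℂ) with hA
  let k : E d × E d → E d × E d → ℂ := fun p z =>
    Complex.exp (Complex.I * ((((innerSL ℝ (x - z.1)).comp (ContinuousLinearMap.fst ℝ (E d) (E d))
          + (innerSL ℝ (x - z.2)).comp (ContinuousLinearMap.snd ℝ (E d) (E d))) p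
          + lam * φ p : ℝ) : ℂ)) * (m p * (f z.1 * g z.2))
  have hexp : ∀ r : ℝ, ‖Complex.exp (Complex.I * (r : ℂ))‖ = 1 := fun r => by
    rw [mul_comm]; exact Complex.norm_exp_ofReal_mul_I r
  have hk : Integrable (Function.uncurry k) ((volume : Measure (E d × E d)).prod volume) := by
    have h1 : Integrable m := hms.integrable_of_hasCompactSupport hmc
    have h2 : Integrable (fun z : E d × E d => f z.1 * g z.2) := f.integrable.mul_prod g.integrable
    have h3 := h1.mul_prod h2
    refine h3.bdd_mul (c := 1) ?_ (Eventually.of_forall fun z => (hexp _).le)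
    apply Continuous.aestronglyMeasurable
    simp only [_root_.add_apply, ContinuousLinearMap.comp_apply, innerSL_apply_apply,
      ContinuousLinearMap.coe_fst', ContinuousLinearMap.coe_snd']
    fun_prop
  have h1 : ∀ p : E d × E d, Complex.exp (Complex.I * ((⟪x, p.1 + p.2⟫ + lam * φ p : ℝ) : ℂ)) *
        m p * FT (⇑f) p.1 * FT (⇑g) p.2 = A ^ 2 * ∫ z, k p z := by
    intro p
    rw [FT, FT]
    have h2 := integral_prod_mul (μ := (volume : Measure (E d))) (ν := (volume : Measure (E d)))
      (fun y => Complex.exp (-(Complex.I * ((⟪y, p.1⟫ : ℝ) : ℂ))) * f y)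
      (fun y => Complex.exp (-(Complex.I * ((⟪y, p.2⟫ : ℝ) : ℂ))) * g y)
    have h3 : ∀ a b c u v : ℂ, a * b * (A * u) * (A * v) = A ^ 2 * (a * b * (u * v)) := by
      intros; ring
    rw [← hA, h3 _ _ 0, ← h2, ← integral_const_mul]
    congr 1
    change _ = ∫ z : E d × E d, k p z ∂((volume : Measure (E d)).prod (volume : Measure (E d)))
    congr 1
    ext z
    simp only [k, _root_.add_apply, ContinuousLinearMap.comp_apply, innerSL_apply_apply,
      ContinuousLinearMap.coe_fst', ContinuousLinearMap.coe_snd']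
    have h4 : Complex.exp (Complex.I * ((⟪x - z.1, p.1⟫ + ⟪x - z.2, p.2⟫ + lam * φ p : ℝ) : ℂ)) =
        Complex.exp (Complex.I * ((⟪x, p.1 + p.2⟫ + lam * φ p : ℝ) : ℂ)) *
        (Complex.exp (-(Complex.I * ((⟪z.1, p.1⟫ : ℝ) : ℂ))) *
          Complex.exp (-(Complex.I * ((⟪z.2, p.2⟫ : ℝ) : ℂ)))) := by
      rw [← Complex.exp_add, ← Complex.exp_add]
      congr 1
      rw [inner_sub_left, inner_sub_left, inner_add_right]
      push_cast
      ring
    rw [h4]; ring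
  rw [Bop, ← hA]
  simp_rw [h1]
  rw [integral_const_mul, integral_integral_swap hk, ← mul_assoc]
  congr 1
  · ring
  congr 1
  ext z
  rw [← integral_const_mul]
  congr 1
  ext p
  simp only [k]
  ring

/-- If `φ, m ∈ C_0^∞(ℝ^{2d})` and `Hess φ` is invertible on `supp m`, then
`‖B_λ(f,g)‖_{L^∞} ≤ C |λ|^{-d} ‖f‖_{L^1} ‖g‖_{L^1}`. -/
theorem statement1 {d : ℕ} (φ : E d × E d → ℝ) (m : E d × E d → ℂ)
    (hφs : ContDiff ℝ (⊤ : ℕ∞) φ) (hφc : HasCompactSupport φ)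
    (hms : ContDiff ℝ (⊤ : ℕ∞) m) (hmc : HasCompactSupport m)
    (hHess : ∀ p ∈ tsupport m, (hessMat φ p).det ≠ 0) :
    ∃ C : ℝ, ∀ lam : ℝ, lam ≠ 0 → ∀ f g : 𝓢(E d, ℂ),
      eLpNorm (Bop m φ lam f g) ⊤ volume ≤
        ENNReal.ofReal (C * |lam| ^ (-(d : ℝ))) *
          (eLpNorm (⇑f) 1 volume * eLpNorm (⇑g) 1 volume) := by
  have : (volume : Measure (E d × E d)).IsAddHaarMeasure :=
    inferInstanceAs (((volume : Measure (E d)).prod (volume : Measure (E d))).IsAddHaarMeasure)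
  obtain ⟨C, hC, hosc⟩ := osc (volume : Measure (E d × E d)) φ m hφs hms hmc
    (fun p hp => hess_inj φ hφs p (hHess p hp))
  set A : ℝ := (2 * Real.pi) ^ (-(d : ℝ) / 2) with hA
  have hA0 : 0 ≤ A := by positivity
  refine ⟨A ^ 3 * C, fun lam hlam f g => ?_⟩
  have hlam' : 0 < |lam| := abs_pos.2 hlam
  have hpow : ((√|lam|) ^ Module.finrank ℝ (E d × E d))⁻¹ = |lam| ^ (-(d : ℝ)) := by
    rw [Real.rpow_neg hlam'.le, Real.rpow_natCast, Module.finrank_prod, finrank_euclideanSpace,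
      Fintype.card_fin, ← two_mul, pow_mul, Real.sq_sqrt hlam'.le]
  replace hosc := hosc lam hlam
  rw [hpow] at hosc
  set D : ℝ := C * |lam| ^ (-(d : ℝ)) with hD
  have hD0 : 0 ≤ D := by positivity
  have hbound : ∀ x, ‖Bop m φ lam f g x‖ ≤ A ^ 3 * D * ((∫ y, ‖f y‖) * ∫ y, ‖g y‖) := by
    intro x
    rw [Bop_eq φ m hφs.continuous hms.continuous hmc, norm_mul, norm_pow, Complex.norm_real,
      Real.norm_of_nonneg hA0, mul_assoc]
    gcongr
    have h2 : Integrable (fun z : E d × E d => f z.1 * g z.2) := f.integrable.mul_prod g.integrable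
    refine (norm_integral_le_of_norm_le (h2.norm.mul_const D)
      (Eventually.of_forall fun z => ?_)).trans (le_of_eq ?_)
    · rw [norm_mul]
      gcongr
      exact hosc _
    · rw [integral_mul_const, mul_comm]
      congr 1
      simp_rw [norm_mul]
      exact integral_prod_mul (fun y => ‖f y‖) (fun y => ‖g y‖)
  have hnorm : ∀ f : 𝓢(E d, ℂ), eLpNorm (⇑f) 1 volume = ENNReal.ofReal (∫ y, ‖f y‖) := by
    intro f
    rw [eLpNorm_one_eq_lintegral_enorm, ofReal_integral_norm_eq_lintegral_enorm f.integrable]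
  rw [hnorm, hnorm, ← ENNReal.ofReal_mul (by positivity), ← ENNReal.ofReal_mul (by positivity)]
  rw [eLpNorm_exponent_top]
  refine eLpNormEssSup_le_of_ae_bound (Eventually.of_forall fun x => ?_)
  refine (hbound x).trans (le_of_eq ?_)
  rw [hD]; ring
end
end
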